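/- For positive integers n and m, there exists an S³-equivariant continuous map f : Sp(n) → Sp(m) (equivariant with respect to the actions of the group of unit quaternions by entrywise left scalar multiplication) if and only if n divides m. -/

import Mathlib

open scoped Quaternion
open Matrix

/-- The compact symplectic group `Sp(n)`: `n × n` quaternionic matrices `A` with
`A * Aᴴ = 1`, with the subspace topology from the space of matrices. -/
abbrev Sp (n : ℕ) : Type :=
  {A : Matrix (Fin n) (Fin n) ℍ[ℝ] // A * Aᴴ = 1}

namespace LinearMap

variable {k W : Type*} [Field k] [AddCommGroup W] [Module k W]

/-- A linear endomorphism with finite-dimensional kernel and cokernel. -/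
def IsAlgFredholm (T : W →ₗ[k] W) : Prop :=
  FiniteDimensional k T.ker ∧ FiniteDimensional k (W ⧸ T.range)

theorem IsAlgFredholm.of_bijective {T : W →ₗ[k] W} (h : Function.Bijective T) :
    T.IsAlgFredholm := by
  constructor
  · rw [LinearMap.ker_eq_bot.2 h.1]; infer_instance
  · rw [LinearMap.range_eq_top.2 h.2]; infer_instance

theorem index_eq_zero_of_bijective {T : W →ₗ[k] W} (h : Function.Bijective T) :
    T.index = 0 :=
  LinearEquiv.index_eq_zero (e := LinearEquiv.ofBijective T h)

theorem IsAlgFredholm.comp {S T : W →ₗ[k] W} (hS : S.IsAlgFredholm) (hT : T.IsAlgFredholm) :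
    (S ∘ₗ T).IsAlgFredholm := by
  obtain ⟨_, _⟩ := hS
  obtain ⟨_, _⟩ := hT
  constructor
  · rw [ker_comp]; infer_instance
  · rw [range_comp]; infer_instance

theorem IsAlgFredholm.index_comp {S T : W →ₗ[k] W} (hS : S.IsAlgFredholm)
    (hT : T.IsAlgFredholm) : (S ∘ₗ T).index = S.index + T.index := by
  obtain ⟨_, _⟩ := hS
  obtain ⟨_, _⟩ := hT
  exact LinearMap.index_comp S

theorem IsAlgFredholm.of_comp {S T R : W →ₗ[k] W} (hST : (S ∘ₗ T).IsAlgFredholm)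
    (hTR : (T ∘ₗ R).IsAlgFredholm) : T.IsAlgFredholm := by
  obtain ⟨_, _⟩ := hST
  obtain ⟨_, _⟩ := hTR
  constructor
  · exact Submodule.finiteDimensional_of_le (LinearMap.ker_le_ker_comp T S)
  · exact Module.Finite.of_surjective _
      (Submodule.factor_surjective (LinearMap.range_comp_le_range R T))

/-- A finite-rank perturbation of the identity is Fredholm of index zero. -/
theorem isAlgFredholm_and_index_id_add {F : W →ₗ[k] W} (hF : F.HasFiniteRange) :
    (id + F).IsAlgFredholm ∧ (id + F).index = 0 := by
  set V := F.range with hV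
  have : FiniteDimensional k V := by
    rw [hasFiniteRange_iff_range] at hF
    exact Module.Finite.iff_fg.2 hF
  set T := id + F with hT
  have hTa (w : W) : T w = w + F w := rfl
  have hFV (w : W) : F w ∈ V := LinearMap.mem_range_self F w
  have hTV : ∀ w ∈ V, T w ∈ V := fun w hw => V.add_mem hw (hFV w)
  have hTV' : ∀ w, T w ∈ V → w ∈ V := fun w hw => by
    have := V.sub_mem hw (hFV w)
    rwa [hTa, add_sub_cancel_right] at this
  let g : V →ₗ[k] V := T.restrict hTV
  have hker : T.ker ≤ V := fun w hw => hTV' w (by rw [LinearMap.mem_ker.1 hw]; exact V.zero_mem)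
  let e₁ : g.ker ≃ₗ[k] T.ker :=
    LinearEquiv.ofBijective
      (LinearMap.codRestrict T.ker (V.subtype ∘ₗ g.ker.subtype) (fun x =>
        congrArg Subtype.val (LinearMap.mem_ker.1 x.2))) (by
      constructor
      · intro x y h
        have := congrArg Subtype.val h
        exact Subtype.ext (Subtype.ext this)
      · rintro ⟨w, hw⟩
        refine ⟨⟨⟨w, hker hw⟩, ?_⟩, rfl⟩
        rw [LinearMap.mem_ker]
        exact Subtype.ext (LinearMap.mem_ker.1 hw))
  let φ : V →ₗ[k] W ⧸ T.range := T.range.mkQ ∘ₗ V.subtype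
  have hφs : Function.Surjective φ := by
    intro y
    obtain ⟨w, rfl⟩ := T.range.mkQ_surjective y
    refine ⟨⟨-F w, V.neg_mem (hFV w)⟩, ?_⟩
    simp only [φ, coe_comp, Function.comp_apply, Submodule.subtype_apply, Submodule.mkQ_apply]
    rw [Submodule.Quotient.eq]
    refine ⟨-w, ?_⟩
    rw [hTa, map_neg]; abel
  have hφk : φ.ker = g.range := by
    ext v
    simp only [φ, LinearMap.mem_ker, coe_comp, Function.comp_apply, Submodule.subtype_apply,
      Submodule.mkQ_apply, Submodule.Quotient.mk_eq_zero]
    constructor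
    · rintro ⟨w, hw⟩
      exact ⟨⟨w, hTV' w (by rw [hw]; exact v.2)⟩, Subtype.ext hw⟩
    · rintro ⟨w, hw⟩
      exact ⟨w, congrArg Subtype.val hw⟩
  let e₂ : (V ⧸ g.range) ≃ₗ[k] (W ⧸ T.range) :=
    (Submodule.quotEquivOfEq _ _ hφk.symm).trans (φ.quotKerEquivOfSurjective hφs)
  refine ⟨⟨Module.Finite.equiv e₁, Module.Finite.equiv e₂⟩, ?_⟩
  have h := index_eq_of_finiteDimensional (f := g)
  rw [index_eq_finrank_sub] at h ⊢
  rw [← e₁.finrank_eq, ← e₂.finrank_eq, h, sub_self]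

end LinearMap

section Approximable

variable (E F : Type*) [NormedAddCommGroup E] [NormedSpace ℂ E] [NormedAddCommGroup F]
  [NormedSpace ℂ F]

/-- The norm closure of the space of bounded operators of finite rank. -/
noncomputable def approximable : Submodule ℂ (E →L[ℂ] F) :=
  ((LinearMap.finiteRange ℂ E F).comap
    (ContinuousLinearMap.coeLM ℂ : (E →L[ℂ] F) →ₗ[ℂ] (E →ₗ[ℂ] F))).topologicalClosure

variable {E F} {G : Type*} [NormedAddCommGroup G] [NormedSpace ℂ G]

theorem mem_approximable_iff {T : E →L[ℂ] F} :
    T ∈ approximable E F ↔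
      ∀ ε > 0, ∃ R : E →L[ℂ] F, R.toLinearMap.HasFiniteRange ∧ ‖T - R‖ < ε := by
  rw [approximable, ← SetLike.mem_coe, Submodule.topologicalClosure_coe, Metric.mem_closure_iff]
  simp only [dist_eq_norm]
  refine forall₂_congr fun ε _ => exists_congr fun R => and_congr ?_ Iff.rfl
  exact LinearMap.mem_finiteRange_iff_hasFiniteRange

theorem isClosed_approximable : IsClosed (approximable E F : Set (E →L[ℂ] F)) :=
  Submodule.isClosed_topologicalClosure _

theorem approximable_comp_right {T : E →L[ℂ] F} (hT : T ∈ approximable E F) (S : G →L[ℂ] E) :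
    T ∘L S ∈ approximable G F := by
  rw [mem_approximable_iff] at hT ⊢
  intro ε hε
  obtain ⟨R, hR, h⟩ := hT (ε / (‖S‖ + 1)) (by positivity)
  refine ⟨R ∘L S, hR.comp_right _, ?_⟩
  rw [← ContinuousLinearMap.sub_comp]
  refine (ContinuousLinearMap.opNorm_comp_le _ _).trans_lt ?_
  rw [lt_div_iff₀ (by positivity)] at h
  nlinarith [norm_nonneg (T - R)]

theorem approximable_comp_left {T : E →L[ℂ] F} (hT : T ∈ approximable E F) (S : F →L[ℂ] G) :
    S ∘L T ∈ approximable E G := by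
  rw [mem_approximable_iff] at hT ⊢
  intro ε hε
  obtain ⟨R, hR, h⟩ := hT (ε / (‖S‖ + 1)) (by positivity)
  refine ⟨S ∘L R, hR.comp_left _, ?_⟩
  rw [← ContinuousLinearMap.comp_sub]
  refine (ContinuousLinearMap.opNorm_comp_le _ _).trans_lt ?_
  rw [lt_div_iff₀ (by positivity)] at h
  nlinarith [norm_nonneg (T - R)]

variable {W : Type*} [NormedAddCommGroup W] [NormedSpace ℂ W] [CompleteSpace W]

theorem bijective_of_norm_sub_one_lt {T : W →L[ℂ] W} (hT : ‖T - 1‖ < 1) :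
    Function.Bijective T := by
  have : IsUnit T := by
    have := isUnit_one_sub_of_norm_lt_one (x := 1 - T) (by rwa [norm_sub_rev])
    rwa [sub_sub_cancel] at this
  obtain ⟨u, rfl⟩ := this
  exact (ContinuousLinearEquiv.unitsEquiv ℂ W u).bijective

theorem isAlgFredholm_and_index_of_sub_one_mem {T : W →L[ℂ] W}
    (hT : T - 1 ∈ approximable W W) :
    T.toLinearMap.IsAlgFredholm ∧ T.toLinearMap.index = 0 := by
  obtain ⟨R, hR, h⟩ := mem_approximable_iff.1 hT 1 one_pos
  set U : W →L[ℂ] W := T - R with hU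
  have hU1 : ‖U - 1‖ < 1 := by rwa [hU, sub_right_comm]
  have hbij := bijective_of_norm_sub_one_lt hU1
  let e := LinearEquiv.ofBijective U.toLinearMap hbij
  have key : T.toLinearMap =
      U.toLinearMap ∘ₗ (LinearMap.id + e.symm.toLinearMap ∘ₗ R.toLinearMap) := by
    ext x
    have : U (e.symm (R x)) = R x := e.apply_symm_apply (R x)
    simp [this]
    simp [hU]
  have h1 := LinearMap.isAlgFredholm_and_index_id_add
    (F := e.symm.toLinearMap ∘ₗ R.toLinearMap) (hR.comp_left _)
  have h2 := LinearMap.IsAlgFredholm.of_bijective hbij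
  have h3 := LinearMap.index_eq_zero_of_bijective hbij
  rw [key]
  refine ⟨h2.comp h1.1, ?_⟩
  rw [h2.index_comp h1.1, h1.2, add_zero]
  exact h3

/-- `S` is an inverse of `T` modulo approximable operators. -/
def IsEssInverse (S T : W →L[ℂ] W) : Prop :=
  S * T - 1 ∈ approximable W W ∧ T * S - 1 ∈ approximable W W

omit [CompleteSpace W] in
theorem IsEssInverse.symm {S T : W →L[ℂ] W} (h : IsEssInverse S T) : IsEssInverse T S :=
  ⟨h.2, h.1⟩

theorem IsEssInverse.isAlgFredholm {S T : W →L[ℂ] W} (h : IsEssInverse S T) :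
    T.toLinearMap.IsAlgFredholm :=
  LinearMap.IsAlgFredholm.of_comp (isAlgFredholm_and_index_of_sub_one_mem h.1).1
    (isAlgFredholm_and_index_of_sub_one_mem h.2).1

theorem IsEssInverse.index_eq_neg {S T : W →L[ℂ] W} (h : IsEssInverse S T) :
    T.toLinearMap.index = -S.toLinearMap.index := by
  have h1 := h.symm.isAlgFredholm.index_comp h.isAlgFredholm
  have h2 : (S.toLinearMap ∘ₗ T.toLinearMap).index = 0 :=
    (isAlgFredholm_and_index_of_sub_one_mem h.1).2
  omega

omit [CompleteSpace W] in
theorem IsEssInverse.congr {S T T' : W →L[ℂ] W} (h : IsEssInverse S T)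
    (hT : T' - T ∈ approximable W W) : IsEssInverse S T' := by
  constructor
  · have := (approximable W W).add_mem h.1 (approximable_comp_left hT S)
    convert this using 1
    change _ = S * T - 1 + S * (T' - T)
    noncomm_ring
  · have := (approximable W W).add_mem h.2 (approximable_comp_right hT S)
    convert this using 1
    change _ = T * S - 1 + (T' - T) * S
    noncomm_ring

theorem IsEssInverse.index_congr {S T T' : W →L[ℂ] W} (h : IsEssInverse S T)
    (hT : T' - T ∈ approximable W W) : T'.toLinearMap.index = T.toLinearMap.index := by
  rw [h.index_eq_neg, (h.congr hT).index_eq_neg]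

end Approximable

section MatrixOperator

variable {ι H : Type*} [Fintype ι] [DecidableEq ι] [NormedAddCommGroup H] [NormedSpace ℂ H]

/-- The operator on `ι → H` given by a matrix of operators on `H`. -/
noncomputable def matOp (M : Matrix ι ι (H →L[ℂ] H)) : (ι → H) →L[ℂ] (ι → H) :=
  ContinuousLinearMap.pi fun i => ∑ j, M i j ∘L ContinuousLinearMap.proj j

omit [DecidableEq ι] in
@[simp]
theorem matOp_apply (M : Matrix ι ι (H →L[ℂ] H)) (x : ι → H) (i : ι) :
    matOp M x i = ∑ j, M i j (x j) := by
  simp [matOp]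

theorem matOp_one : matOp (1 : Matrix ι ι (H →L[ℂ] H)) = 1 := by
  ext x i
  simp only [matOp_apply, one_apply_eq_self]
  rw [Finset.sum_eq_single i]
  · simp
  · intro j _ hj; simp [Matrix.one_apply_ne hj.symm]
  · simp

omit [DecidableEq ι] in
theorem matOp_mul (M N : Matrix ι ι (H →L[ℂ] H)) : matOp (M * N) = matOp M * matOp N := by
  ext x i
  simp only [matOp_apply, mul_apply_eq_comp, Matrix.mul_apply,
    _root_.sum_apply, map_sum]
  exact Finset.sum_comm

omit [DecidableEq ι] in
theorem matOp_sub (M N : Matrix ι ι (H →L[ℂ] H)) : matOp (M - N) = matOp M - matOp N := by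
  ext x i
  simp [Finset.sum_sub_distrib]

omit [DecidableEq ι] in
theorem norm_matOp_le {M : Matrix ι ι (H →L[ℂ] H)} {c : ℝ} (hc : 0 ≤ c)
    (hM : ∀ i j, ‖M i j‖ ≤ c) : ‖matOp M‖ ≤ Fintype.card ι * c := by
  refine ContinuousLinearMap.opNorm_le_bound _ (by positivity) fun x => ?_
  refine (pi_norm_le_iff_of_nonneg (by positivity)).2 fun i => ?_
  rw [matOp_apply]
  refine (norm_sum_le _ _).trans ?_
  calc ∑ j, ‖M i j (x j)‖ ≤ ∑ _j : ι, c * ‖x‖ := by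
        refine Finset.sum_le_sum fun j _ => ?_
        refine (ContinuousLinearMap.le_opNorm _ _).trans ?_
        gcongr
        · exact hM i j
        · exact norm_le_pi_norm x j
    _ = Fintype.card ι * c * ‖x‖ := by simp [mul_assoc]

theorem matOp_mem_approximable {M : Matrix ι ι (H →L[ℂ] H)}
    (hM : ∀ i j, M i j ∈ approximable H H) : matOp M ∈ approximable (ι → H) (ι → H) := by
  have : matOp M = ∑ i, ∑ j, ContinuousLinearMap.single ℂ (fun _ : ι => H) i ∘L
      (M i j ∘L ContinuousLinearMap.proj j) := by
    ext x i
    simp only [matOp_apply, _root_.sum_apply, Finset.sum_apply,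
      ContinuousLinearMap.comp_apply, ContinuousLinearMap.proj_apply,
      ContinuousLinearMap.single_apply]
    simp [Pi.single_apply]
  rw [this]
  exact Submodule.sum_mem _ fun i _ => Submodule.sum_mem _ fun j _ =>
    approximable_comp_left (approximable_comp_right (hM i j) _) _

end MatrixOperator

/-- A contractive unital linear map from continuous functions to operators that is
multiplicative modulo approximable operators. -/
structure ToeplitzMap (X H : Type*) [TopologicalSpace X] [CompactSpace X]
    [NormedAddCommGroup H] [NormedSpace ℂ H] where
  /-- The underlying linear map. -/
  toLin : C(X, ℂ) →ₗ[ℂ] (H →L[ℂ] H)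
  map_one : toLin 1 = 1
  norm_le : ∀ f, ‖toLin f‖ ≤ ‖f‖
  mul_sub_mem : ∀ f g, toLin (f * g) - toLin f * toLin g ∈ approximable H H

namespace ToeplitzMap

variable {X H ι : Type*} [TopologicalSpace X] [CompactSpace X] [NormedAddCommGroup H]
  [NormedSpace ℂ H] [Fintype ι] [DecidableEq ι] (τ : ToeplitzMap X H)

/-- The Toeplitz operator of a matrix-valued symbol. -/
noncomputable def op (G : Matrix ι ι C(X, ℂ)) : (ι → H) →L[ℂ] (ι → H) :=
  matOp (G.map τ.toLin)

/-- The index of the Toeplitz operator of a matrix-valued symbol. -/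
noncomputable def deg (G : Matrix ι ι C(X, ℂ)) : ℤ := (τ.op G).toLinearMap.index

theorem op_one : τ.op (1 : Matrix ι ι C(X, ℂ)) = 1 := by
  rw [op, Matrix.map_one _ (map_zero _) τ.map_one, matOp_one]

theorem op_mul_sub_mem (F G : Matrix ι ι C(X, ℂ)) :
    τ.op (F * G) - τ.op F * τ.op G ∈ approximable (ι → H) (ι → H) := by
  rw [op, op, op, ← matOp_mul, ← matOp_sub]
  refine matOp_mem_approximable fun i j => ?_
  simp only [Matrix.sub_apply, Matrix.map_apply, Matrix.mul_apply, map_sum,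
    ← Finset.sum_sub_distrib]
  exact Submodule.sum_mem _ fun k _ => τ.mul_sub_mem _ _

theorem isEssInverse {F G : Matrix ι ι C(X, ℂ)} (h : F * G = 1) :
    IsEssInverse (τ.op F) (τ.op G) := by
  have h1 := τ.op_mul_sub_mem F G
  have h2 := τ.op_mul_sub_mem G F
  rw [h, op_one, ← Submodule.neg_mem_iff, neg_sub] at h1
  rw [mul_eq_one_comm.1 h, op_one, ← Submodule.neg_mem_iff, neg_sub] at h2
  exact ⟨h1, h2⟩

variable [CompleteSpace H]

theorem deg_mul {F G : Matrix ι ι C(X, ℂ)} (hF : IsUnit F) (hG : IsUnit G) :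
    τ.deg (F * G) = τ.deg F + τ.deg G := by
  obtain ⟨F', hF'⟩ := hF.exists_left_inv
  obtain ⟨G', hG'⟩ := hG.exists_left_inv
  have hFG : G' * F' * (F * G) = 1 := by
    rw [mul_assoc, ← mul_assoc F', hF', one_mul, hG']
  have h := (τ.isEssInverse hFG).index_congr (T' := τ.op F * τ.op G) (by
    rw [← Submodule.neg_mem_iff, neg_sub]; exact τ.op_mul_sub_mem F G)
  rw [deg, ← h]
  exact (τ.isEssInverse hF').isAlgFredholm.index_comp (τ.isEssInverse hG').isAlgFredholm

theorem deg_eq_zero_of_close {G : Matrix ι ι C(X, ℂ)}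
    (h : ∀ i j, ‖G i j - (1 : Matrix ι ι C(X, ℂ)) i j‖ ≤ 1 / (Fintype.card ι + 1)) :
    τ.deg G = 0 := by
  refine LinearMap.index_eq_zero_of_bijective (bijective_of_norm_sub_one_lt ?_)
  rw [← τ.op_one, op, op, ← matOp_sub]
  refine (norm_matOp_le (c := 1 / (Fintype.card ι + 1)) (by positivity) fun i j => ?_).trans_lt ?_
  · simp only [Matrix.sub_apply, Matrix.map_apply, ← map_sub]
    exact (τ.norm_le _).trans (h i j)
  · rw [mul_one_div, div_lt_one (by positivity)]
    linarith

omit [DecidableEq ι] [CompleteSpace H] in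
theorem op_map_algebraMap_mul (C D : Matrix ι ι ℂ) :
    τ.op (C.map (algebraMap ℂ C(X, ℂ))) * τ.op (D.map (algebraMap ℂ C(X, ℂ))) =
      τ.op ((C * D).map (algebraMap ℂ C(X, ℂ))) := by
  have key (E : Matrix ι ι ℂ) : (E.map (algebraMap ℂ C(X, ℂ))).map τ.toLin =
      E.map (algebraMap ℂ (H →L[ℂ] H)) := by
    ext i j : 2
    simp only [Matrix.map_apply, Algebra.algebraMap_eq_smul_one, map_smul, τ.map_one]
  rw [op, op, op, key, key, key, ← matOp_mul, Matrix.map_mul]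

omit [CompleteSpace H] in
theorem deg_const {C : Matrix ι ι ℂ} (hC : IsUnit C) :
    τ.deg (C.map (algebraMap ℂ C(X, ℂ))) = 0 := by
  obtain ⟨D, hD⟩ := hC.exists_left_inv
  have h1 := τ.op_map_algebraMap_mul D C
  have h2 := τ.op_map_algebraMap_mul C D
  rw [hD, Matrix.map_one _ (map_zero _) (_root_.map_one _), op_one] at h1
  rw [mul_eq_one_comm.1 hD, Matrix.map_one _ (map_zero _) (_root_.map_one _), op_one] at h2
  refine LinearMap.index_eq_zero_of_bijective
    (Function.bijective_iff_has_inverse.2 ⟨τ.op (D.map (algebraMap ℂ C(X, ℂ))), ?_, ?_⟩)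
  · intro x; exact DFunLike.congr_fun h1 x
  · intro x; exact DFunLike.congr_fun h2 x

/-- The Toeplitz index is locally constant on invertible symbols. -/
theorem deg_eq_of_continuous {Y : Type*} [TopologicalSpace Y] [PreconnectedSpace Y]
    {G : Y → Matrix ι ι C(X, ℂ)} (hG : Continuous G) (hu : ∀ y, IsUnit (G y)) (y z : Y) :
    τ.deg (G y) = τ.deg (G z) := by
  refine IsLocallyConstant.apply_eq_of_isPreconnected
    ((IsLocallyConstant.iff_eventually_eq fun y => τ.deg (G y)).2 fun y => ?_)
    isPreconnected_univ (Set.mem_univ y) (Set.mem_univ z)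
  obtain ⟨F, hF⟩ := (hu y).exists_left_inv
  have hFu : IsUnit F := IsUnit.of_mul_eq_one _ hF
  have hc : Continuous fun z => F * G z := continuous_const.matrix_mul hG
  have hev : ∀ᶠ z in nhds y, ∀ i j,
      ‖(F * G z) i j - (1 : Matrix ι ι C(X, ℂ)) i j‖ ≤ 1 / (Fintype.card ι + 1) := by
    rw [Filter.eventually_all]; intro i
    rw [Filter.eventually_all]; intro j
    have hcij : Continuous fun z => ‖(F * G z) i j - (1 : Matrix ι ι C(X, ℂ)) i j‖ :=
      ((hc.matrix_elem i j).sub continuous_const).norm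
    have : ‖(F * G y) i j - (1 : Matrix ι ι C(X, ℂ)) i j‖ < 1 / (Fintype.card ι + 1) := by
      rw [hF, sub_self, norm_zero]; positivity
    exact (hcij.continuousAt.eventually_lt continuousAt_const this).mono fun _ h => h.le
  filter_upwards [hev] with z hz
  have h1 := τ.deg_eq_zero_of_close hz
  rw [τ.deg_mul hFu (hu z)] at h1
  have h2 : τ.deg (F * G y) = 0 := by
    rw [hF]
    exact τ.deg_eq_zero_of_close fun i j => by rw [sub_self, norm_zero]; positivity
  rw [τ.deg_mul hFu (hu y)] at h2
  omega

end ToeplitzMap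

section MultiplicationOperator

open MeasureTheory

variable {Y : Type*} [TopologicalSpace Y] [CompactSpace Y]
  [MeasurableSpace Y] [BorelSpace Y] (μ : Measure Y) [IsFiniteMeasure μ]

/-- The operator on `L²` of multiplication by a continuous function. -/
noncomputable def mulOpAux (f : C(Y, ℂ)) : Lp ℂ 2 μ →L[ℂ] Lp ℂ 2 μ :=
  (ContinuousLinearMap.mul ℂ ℂ).holderL μ ⊤ 2 2 (ContinuousMap.toLp ⊤ μ ℂ f)

theorem coeFn_mulOpAux (f : C(Y, ℂ)) (g : Lp ℂ 2 μ) :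
    mulOpAux μ f g =ᵐ[μ] fun y => f y * g y := by
  have h1 := (ContinuousLinearMap.mul ℂ ℂ).coeFn_holder (r := 2) (ContinuousMap.toLp ⊤ μ ℂ f) g
  have h2 := ContinuousMap.coeFn_toLp (p := ⊤) (𝕜 := ℂ) μ f
  filter_upwards [h1, h2] with y h1 h2
  rw [← h2]
  exact h1

/-- Multiplication by continuous functions, as a `*`-representation on `L²`. -/
noncomputable def mulOp : C(Y, ℂ) →⋆ₐ[ℂ] (Lp ℂ 2 μ →L[ℂ] Lp ℂ 2 μ) where
  toFun := mulOpAux μ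
  map_one' := by
    ext1 g
    refine Lp.ext ?_
    filter_upwards [coeFn_mulOpAux μ 1 g] with y h
    simpa using h
  map_mul' f f' := by
    ext1 g
    refine Lp.ext ?_
    filter_upwards [coeFn_mulOpAux μ (f * f') g, coeFn_mulOpAux μ f (mulOpAux μ f' g),
      coeFn_mulOpAux μ f' g] with y h1 h2 h3
    rw [h1]
    simp [h2, h3, mul_assoc]
  map_zero' := by simp [mulOpAux]
  map_add' f f' := by simp [mulOpAux]
  commutes' c := by
    ext1 g
    refine Lp.ext ?_
    filter_upwards [coeFn_mulOpAux μ (algebraMap ℂ _ c) g, Lp.coeFn_smul c g] with y h h'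
    rw [h, Algebra.algebraMap_eq_smul_one, Algebra.algebraMap_eq_smul_one]
    simpa using h'.symm
  map_star' f := by
    rw [ContinuousLinearMap.star_eq_adjoint, ContinuousLinearMap.eq_adjoint_iff]
    intro g h
    rw [L2.inner_def, L2.inner_def]
    refine integral_congr_ae ?_
    filter_upwards [coeFn_mulOpAux μ (star f) g, coeFn_mulOpAux μ f h] with y h1 h2
    simp [h1, h2]
    ring

theorem mulOp_toLp (f g : C(Y, ℂ)) :
    mulOp μ f (ContinuousMap.toLp 2 μ ℂ g) = ContinuousMap.toLp 2 μ ℂ (f * g) := by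
  refine Lp.ext ?_
  filter_upwards [coeFn_mulOpAux μ f (ContinuousMap.toLp 2 μ ℂ g),
    ContinuousMap.coeFn_toLp (p := 2) (𝕜 := ℂ) μ g,
    ContinuousMap.coeFn_toLp (p := 2) (𝕜 := ℂ) μ (f * g)] with y h1 h2 h3
  rw [h3]
  exact h1.trans (by rw [h2]; rfl)

end MultiplicationOperator

section Compression

open ContinuousLinearMap

variable {E H : Type*}
  [NormedAddCommGroup E] [InnerProductSpace ℂ E] [CompleteSpace E]
  [NormedAddCommGroup H] [InnerProductSpace ℂ H] [CompleteSpace H]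
  (J : H →ₗᵢ[ℂ] E)

/-- The compression of an operator to a closed subspace. -/
noncomputable def compr (T : E →L[ℂ] E) : H →L[ℂ] H :=
  adjoint J.toContinuousLinearMap ∘L T ∘L J.toContinuousLinearMap

noncomputable def defect (T : E →L[ℂ] E) : H →L[ℂ] E :=
  T ∘L J.toContinuousLinearMap - J.toContinuousLinearMap ∘L compr J T

theorem adjoint_linearIsometry_apply (x : H) :
    adjoint J.toContinuousLinearMap (J x) = x :=
  DFunLike.congr_fun J.adjoint_comp_self x

theorem defect_mul (S T : E →L[ℂ] E) : defect J (S * T) = defect J S ∘L compr J T +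
    S ∘L defect J T - J.toContinuousLinearMap ∘L adjoint J.toContinuousLinearMap ∘L
      S ∘L defect J T := by
  ext x
  simp [defect, compr]
  
theorem compr_mul_sub (S T : E →L[ℂ] E) : compr J (S * T) - compr J S * compr J T =
    (adjoint J.toContinuousLinearMap ∘L S) ∘L defect J T := by
  ext x
  simp [defect, compr]

theorem norm_compr_le (T : E →L[ℂ] E) : ‖compr J T‖ ≤ ‖T‖ := by
  have hJ : ‖J.toContinuousLinearMap‖ ≤ 1 := J.norm_toContinuousLinearMap_le
  have hJ' : ‖adjoint J.toContinuousLinearMap‖ ≤ 1 := by rwa [LinearIsometryEquiv.norm_map]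
  calc ‖compr J T‖ ≤ ‖adjoint J.toContinuousLinearMap‖ * (‖T‖ * ‖J.toContinuousLinearMap‖) :=
        (opNorm_comp_le _ _).trans (by gcongr; exact opNorm_comp_le _ _)
    _ ≤ 1 * (‖T‖ * 1) := by gcongr
    _ = ‖T‖ := by ring

theorem compr_star (T : E →L[ℂ] E) : compr J (star T) = adjoint (compr J T) := by
  simp [compr, star_eq_adjoint, adjoint_comp, comp_assoc]

theorem continuous_defect : Continuous (defect J) := by
  unfold defect compr
  fun_prop

variable {X : Type*} [TopologicalSpace X] [CompactSpace X] (M : C(X, ℂ) →⋆ₐ[ℂ] (E →L[ℂ] E))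

/-- The continuous functions whose multiplication operators preserve a closed subspace up to
an approximable error. -/
def essInvariantSubalgebra : Subalgebra ℂ C(X, ℂ) where
  carrier := {g | defect J (M g) ∈ approximable H E}
  mul_mem' {f g} hf hg := by
    simp only [Set.mem_ofPred_eq, map_mul, defect_mul] at hf hg ⊢
    exact sub_mem (add_mem (approximable_comp_right hf _) (approximable_comp_left hg _))
      (approximable_comp_left (approximable_comp_left (approximable_comp_left hg _) _) _)
  add_mem' {f g} hf hg := by
    have : defect J (M (f + g)) = defect J (M f) + defect J (M g) := by
      ext x; simp [defect, compr]; abel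
    simpa only [Set.mem_ofPred_eq, this] using add_mem hf hg
  algebraMap_mem' c := by
    have : defect J (M (algebraMap ℂ _ c)) = 0 := by
      ext x; simp [defect, compr, Algebra.algebraMap_eq_smul_one, adjoint_linearIsometry_apply]
    simp only [Set.mem_ofPred_eq, this, zero_mem]

theorem essInvariantSubalgebra_eq_top {s : Set C(X, ℂ)}
    (hs : ∀ x y : X, x ≠ y → ∃ f ∈ s, f x ≠ f y) (h1 : ∀ f ∈ s, defect J (M f) ∈ approximable H E)
    (h2 : ∀ f ∈ s, defect J (M (star f)) ∈ approximable H E) :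
    essInvariantSubalgebra J M = ⊤ := by
  have hcont : Continuous M :=
    AddMonoidHomClass.continuous_of_bound M 1 fun f => by
      simpa only [one_mul] using NonUnitalStarAlgHom.norm_apply_le M f
  have hclosed : IsClosed (essInvariantSubalgebra J M : Set C(X, ℂ)) :=
    isClosed_approximable.preimage ((continuous_defect J).comp hcont)
  have hle : (StarAlgebra.adjoin ℂ s).toSubalgebra ≤ essInvariantSubalgebra J M := by
    rw [StarAlgebra.adjoin_toSubalgebra, Algebra.adjoin_le_iff]
    rintro f (hf | hf)
    · exact h1 f hf
    · have := h2 _ hf; rwa [star_star] at this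
  have hsep : (StarAlgebra.adjoin ℂ s).SeparatesPoints := by
    intro x y hxy
    obtain ⟨f, hf, hne⟩ := hs x y hxy
    exact ⟨f, ⟨f, StarAlgebra.subset_adjoin ℂ s hf, rfl⟩, hne⟩
  have htop := ContinuousMap.starSubalgebra_topologicalClosure_eq_top_of_separatesPoints _ hsep
  refine top_le_iff.1 fun f _ => ?_
  have hf : f ∈ (StarAlgebra.adjoin ℂ s).topologicalClosure := by rw [htop]; trivial
  exact closure_minimal hle hclosed hf

/-- The Toeplitz quantization obtained by compressing a `*`-representation. -/
noncomputable def ToeplitzMap.ofCompression (h : essInvariantSubalgebra J M = ⊤) :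
    ToeplitzMap X H where
  toLin :=
    { toFun f := compr J (M f)
      map_add' f g := by ext x; simp [compr]
      map_smul' c f := by ext x; simp [compr] }
  map_one := by ext x; simp [compr, adjoint_linearIsometry_apply]
  norm_le f := (norm_compr_le J _).trans
    (NonUnitalStarAlgHom.norm_apply_le M f)
  mul_sub_mem f g := by
    have hg : g ∈ essInvariantSubalgebra J M := by rw [h]; trivial
    have := approximable_comp_left hg (adjoint J.toContinuousLinearMap ∘L M f)
    rw [← compr_mul_sub, ← map_mul] at this
    exact this

end Compression

section WeightedShift

open ContinuousLinearMap
open scoped InnerProductSpace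

variable {I E : Type*} [DecidableEq I] [NormedAddCommGroup E] [InnerProductSpace ℂ E]

/-- The standard basis vectors of `ℓ²(I)`. -/
noncomputable def ltwoBasis (i : I) : lp (fun _ : I => ℂ) 2 := lp.single 2 i 1

theorem inner_ltwoBasis (i : I) (x : lp (fun _ : I => ℂ) 2) : ⟪ltwoBasis i, x⟫_ℂ = x i := by
  simp [ltwoBasis, lp.inner_single_left]

theorem ltwoBasis_apply (i j : I) : ltwoBasis i j = if j = i then (1 : ℂ) else 0 := by
  simp [ltwoBasis, Pi.single_apply]

theorem clm_ext_ltwoBasis {f g : lp (fun _ : I => ℂ) 2 →L[ℂ] E}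
    (h : ∀ i, f (ltwoBasis i) = g (ltwoBasis i)) : f = g := by
  refine lp.ext_continuousLinearMap (by norm_num) fun i => ?_
  ext
  exact h i

omit [DecidableEq I] in
theorem hasSum_norm_sq_ltwo (x : lp (fun _ : I => ℂ) 2) :
    HasSum (fun i => ‖x i‖ ^ 2) (‖x‖ ^ 2) := by
  have := lp.hasSum_norm (p := 2) (by norm_num) x
  simpa using this

/-- The projection of `ℓ²(I)` onto a finite set of coordinates. -/
noncomputable def coordProj (F : Finset I) :
    lp (fun _ : I => ℂ) 2 →L[ℂ] lp (fun _ : I => ℂ) 2 :=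
  ∑ i ∈ F, (innerSL ℂ (ltwoBasis i)).smulRight (ltwoBasis i)

theorem coordProj_apply (F : Finset I) (x : lp (fun _ : I => ℂ) 2) (j : I) :
    coordProj F x j = if j ∈ F then x j else 0 := by
  rw [← inner_ltwoBasis]
  simp [coordProj, inner_ltwoBasis, ltwoBasis_apply]

theorem hasFiniteRange_coordProj (F : Finset I) : (coordProj F).toLinearMap.HasFiniteRange := by
  have : (coordProj F).toLinearMap =
      ∑ i ∈ F, ((innerSL ℂ (ltwoBasis i)).smulRight (ltwoBasis i)).toLinearMap := by
    ext x : 1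
    simp [coordProj]
  rw [this]
  rw [← LinearMap.mem_finiteRange_iff_hasFiniteRange]
  refine Submodule.sum_mem _ fun i _ => ?_
  rw [LinearMap.mem_finiteRange_iff_hasFiniteRange]
  have h : (LinearMap.toSpanSingleton ℂ (lp (fun _ : I => ℂ) 2) (ltwoBasis i)).HasFiniteRange :=
    LinearMap.HasFiniteRange.of_finite_dom
  exact h.comp_right (innerSL ℂ (ltwoBasis i)).toLinearMap

/-- An operator whose quadratic form is diagonal with entries tending to zero is approximable. -/
theorem mem_approximable_of_norm_sq {K : lp (fun _ : I => ℂ) 2 →L[ℂ] E} {d : I → ℝ}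
    (hK : ∀ x, HasSum (fun i => d i * ‖x i‖ ^ 2) (‖K x‖ ^ 2))
    (hd : ∀ ε > 0, {i | ε < d i}.Finite) : K ∈ approximable (lp (fun _ : I => ℂ) 2) E := by
  rw [mem_approximable_iff]
  intro ε hε
  let F := (hd ((ε / 2) ^ 2) (by positivity)).toFinset
  refine ⟨K ∘L coordProj F, ?_, ?_⟩
  · exact (hasFiniteRange_coordProj F).comp_left K.toLinearMap
  · have : ‖K - K ∘L coordProj F‖ ≤ ε / 2 := by
      refine opNorm_le_bound _ (by positivity) fun x => ?_
      refine abs_le_of_sq_le_sq' ?_ (by positivity) |>.2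
      have h1 : (K - K ∘L coordProj F) x = K (x - coordProj F x) := by simp
      rw [h1, mul_pow]
      refine hasSum_le (fun i => ?_) (hK _) ((hasSum_norm_sq_ltwo x).mul_left _)
      simp only [lp.coeFn_sub, Pi.sub_apply, coordProj_apply]
      split_ifs with hi
      · simp; positivity
      · rw [sub_zero]
        gcongr
        simpa [F] using hi
    linarith

variable {N : lp (fun _ : I => ℂ) 2 →L[ℂ] lp (fun _ : I => ℂ) 2} {s : I → I} {w v : I → ℝ}

theorem adjoint_weightedShift_apply (hN : ∀ i, N (ltwoBasis i) = (w i : ℂ) • ltwoBasis (s i))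
    (x : lp (fun _ : I => ℂ) 2) (i : I) : adjoint N x i = w i * x (s i) := by
  rw [← inner_ltwoBasis, adjoint_inner_right, hN, inner_smul_left, inner_ltwoBasis,
    Complex.conj_ofReal]

theorem weightedShift_apply (hs : s.Injective)
    (hN : ∀ i, N (ltwoBasis i) = (w i : ℂ) • ltwoBasis (s i))
    (x : lp (fun _ : I => ℂ) 2) (i : I) : N x (s i) = w i * x i := by
  have h : adjoint N (ltwoBasis (s i)) = (w i : ℂ) • ltwoBasis i := by
    ext j
    rw [adjoint_weightedShift_apply hN]
    simp only [ltwoBasis_apply, hs.eq_iff, lp.coeFn_smul, Pi.smul_apply, smul_eq_mul]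
    split_ifs with hj <;> simp [hj]
  rw [← inner_ltwoBasis, ← adjoint_inner_left, h, inner_smul_left, inner_ltwoBasis,
    Complex.conj_ofReal]

theorem weightedShift_apply_of_notMem
    (hN : ∀ i, N (ltwoBasis i) = (w i : ℂ) • ltwoBasis (s i))
    (x : lp (fun _ : I => ℂ) 2) {j : I} (hj : j ∉ Set.range s) : N x j = 0 := by
  have h : adjoint N (ltwoBasis j) = 0 := by
    ext k
    rw [adjoint_weightedShift_apply hN, ltwoBasis_apply, if_neg fun h => hj ⟨k, h⟩]
    simp
  rw [← inner_ltwoBasis, ← adjoint_inner_left, h, inner_zero_left]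

theorem hasSum_norm_sq_sub_weightedShift (hs : s.Injective)
    (hN : ∀ i, N (ltwoBasis i) = (w i : ℂ) • ltwoBasis (s i))
    (hv : ∀ i, v (s i) = w i ^ 2) (hv' : ∀ j ∉ Set.range s, v j = 0)
    (x : lp (fun _ : I => ℂ) 2) :
    HasSum (fun i => (w i ^ 2 - v i) * ‖x i‖ ^ 2) (‖N x‖ ^ 2 - ‖adjoint N x‖ ^ 2) := by
  have h1 := lp.hasSum_inner (𝕜 := ℂ) x (adjoint N (N x) - N (adjoint N x))
  have h2 : (⟪x, adjoint N (N x) - N (adjoint N x)⟫_ℂ) =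
      ((‖N x‖ ^ 2 - ‖adjoint N x‖ ^ 2 : ℝ) : ℂ) := by
    rw [inner_sub_right, adjoint_inner_right N x (N x), ← adjoint_inner_left N (adjoint N x) x,
      inner_self_eq_norm_sq_to_K, inner_self_eq_norm_sq_to_K]
    simp
  rw [h2] at h1
  have h3 := Complex.hasSum_re h1
  rw [Complex.ofReal_re] at h3
  convert h3 using 2 with i
  have h4 : (adjoint N (N x) - N (adjoint N x)) i = ((w i ^ 2 - v i : ℝ) : ℂ) * x i := by
    simp only [lp.coeFn_sub, Pi.sub_apply]
    rw [adjoint_weightedShift_apply hN, weightedShift_apply hs hN]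
    by_cases hi : i ∈ Set.range s
    · obtain ⟨j, rfl⟩ := hi
      rw [weightedShift_apply hs hN, adjoint_weightedShift_apply hN, hv]
      push_cast; ring
    · rw [weightedShift_apply_of_notMem hN _ hi, hv' i hi]
      push_cast; ring
  rw [h4, RCLike.inner_apply, mul_assoc, Complex.mul_conj, Complex.normSq_eq_norm_sq,
    ← Complex.ofReal_mul, Complex.ofReal_re]

variable [CompleteSpace E] {J : lp (fun _ : I => ℂ) 2 →ₗᵢ[ℂ] E} {T : E →L[ℂ] E}

theorem compr_ltwoBasis (hT : ∀ i, T (J (ltwoBasis i)) = (w i : ℂ) • J (ltwoBasis (s i))) (i : I) :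
    compr J T (ltwoBasis i) = (w i : ℂ) • ltwoBasis (s i) := by
  have h : compr J T (ltwoBasis i) =
      adjoint J.toContinuousLinearMap (T (J (ltwoBasis i))) := rfl
  rw [h, hT, map_smul, adjoint_linearIsometry_apply]

theorem defect_eq_zero (hT : ∀ i, T (J (ltwoBasis i)) = (w i : ℂ) • J (ltwoBasis (s i))) :
    defect J T = 0 := by
  refine clm_ext_ltwoBasis fun i => ?_
  simp [defect, compr_ltwoBasis hT, hT]

omit [DecidableEq I] in
theorem norm_sub_adjoint_sq (y : E) :
    ‖y - J (adjoint J.toContinuousLinearMap y)‖ ^ 2 =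
      ‖y‖ ^ 2 - ‖adjoint J.toContinuousLinearMap y‖ ^ 2 := by
  have h : ⟪y, J (adjoint J.toContinuousLinearMap y)⟫_ℂ =
      ⟪adjoint J.toContinuousLinearMap y, adjoint J.toContinuousLinearMap y⟫_ℂ :=
    (adjoint_inner_left J.toContinuousLinearMap _ y).symm
  rw [norm_sub_sq (𝕜 := ℂ), h, inner_self_eq_norm_sq_to_K, J.norm_map]
  norm_cast
  ring

theorem defect_star_mem_approximable (hs : s.Injective)
    (hT : ∀ i, T (J (ltwoBasis i)) = (w i : ℂ) • J (ltwoBasis (s i)))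
    (hnormal : IsStarNormal T)
    (hv : ∀ i, v (s i) = w i ^ 2) (hv' : ∀ j ∉ Set.range s, v j = 0)
    (hd : ∀ ε > 0, {i | ε < w i ^ 2 - v i}.Finite) :
    defect J (star T) ∈ approximable _ E := by
  refine mem_approximable_of_norm_sq (d := fun i => w i ^ 2 - v i) (fun x => ?_) hd
  have h := hasSum_norm_sq_sub_weightedShift hs (compr_ltwoBasis hT) hv hv' x
  convert h using 1
  have h1 : ‖star T (J x)‖ = ‖compr J T x‖ := by
    have : T (J x) = J (compr J T x) := sub_eq_zero.1 (DFunLike.congr_fun (defect_eq_zero hT) x)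
    rw [star_eq_adjoint, ← isStarNormal_iff_norm_eq_adjoint.1 hnormal, this, J.norm_map]
  rw [← compr_star, ← h1]
  exact norm_sub_adjoint_sq (star T (J x))

end WeightedShift

section HopfCoordinates

open MeasureTheory
open scoped InnerProductSpace ComplexConjugate Nat

theorem integral_unitInterval_pow_mul_pow (a b : ℕ) :
    ∫ s : unitInterval, ((s : ℝ) : ℂ) ^ a * (1 - ((s : ℝ) : ℂ)) ^ b =
      ((a ! * b ! / (a + b + 1)! : ℝ) : ℂ) := by
  have h := Complex.betaIntegral_eq_Gamma_mul_div (a + 1) (b + 1)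
    (by simp; positivity) (by simp; positivity)
  have h2 : (a + 1 + (b + 1) : ℂ) = ((a + b + 1 : ℕ) : ℂ) + 1 := by push_cast; ring
  rw [h2, Complex.Gamma_nat_eq_factorial, Complex.Gamma_nat_eq_factorial,
    Complex.Gamma_nat_eq_factorial, Complex.betaIntegral, intervalIntegral.integral_of_le zero_le_one,
    ← integral_Icc_eq_integral_Ioc] at h
  rw [unitInterval.volume_def, integral_subtype_comap measurableSet_Icc
    (fun s : ℝ => (s : ℂ) ^ a * (1 - (s : ℂ)) ^ b)]
  push_cast
  rw [← h]
  congr! 2 with s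
  simp

theorem fourier_one_pow {x : UnitAddCircle} (a : ℕ) : fourier 1 x ^ a = fourier (a : ℤ) x := by
  induction a with
  | zero => simp
  | succ a ih => rw [pow_succ, ih, Nat.cast_succ, fourier_add]

theorem integral_fourier_mul_conj_fourier (a b : ℤ) :
    ∫ x : UnitAddCircle, fourier b x * conj (fourier a x) ∂AddCircle.haarAddCircle =
      if a = b then 1 else 0 := by
  rw [← orthonormal_iff_ite.1 (orthonormal_fourier (T := 1)) a b]
  exact (ContinuousMap.inner_toLp (μ := AddCircle.haarAddCircle) (fourier a) (fourier b)).symm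

/-- The domain of Hopf coordinates on the unit sphere in `ℂ²`. -/
abbrev HopfDomain : Type := unitInterval × UnitAddCircle × UnitAddCircle

/-- The measure on Hopf coordinates corresponding to the uniform measure on the sphere. -/
noncomputable def hopfMeasure : Measure HopfDomain :=
  (volume : Measure unitInterval).prod
    ((AddCircle.haarAddCircle : Measure UnitAddCircle).prod AddCircle.haarAddCircle)

instance : IsProbabilityMeasure hopfMeasure := by
  unfold hopfMeasure; infer_instance

/-- The first complex coordinate. -/
noncomputable def hopfFst : C(HopfDomain, ℂ) where
  toFun y := (√(y.1 : ℝ) : ℂ) * fourier 1 y.2.1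
  continuous_toFun := by fun_prop

/-- The second complex coordinate. -/
noncomputable def hopfSnd : C(HopfDomain, ℂ) where
  toFun y := (√(1 - (y.1 : ℝ)) : ℂ) * fourier 1 y.2.2
  continuous_toFun := by fun_prop

theorem integral_hopf_monomials (a b c d : ℕ) :
    ∫ y, (hopfFst ^ c * hopfSnd ^ d) y * conj ((hopfFst ^ a * hopfSnd ^ b) y) ∂hopfMeasure =
      if (a, b) = (c, d) then ((a ! * b ! / (a + b + 1)! : ℝ) : ℂ) else 0 := by
  have h (y : HopfDomain) :
      (hopfFst ^ c * hopfSnd ^ d) y * conj ((hopfFst ^ a * hopfSnd ^ b) y) =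
      ((√(y.1 : ℝ) : ℂ) ^ (a + c) * (√(1 - (y.1 : ℝ)) : ℂ) ^ (b + d)) *
      ((fourier c y.2.1 * conj (fourier a y.2.1)) *
        (fourier d y.2.2 * conj (fourier b y.2.2))) := by
    simp only [hopfFst, hopfSnd, ContinuousMap.mul_apply, ContinuousMap.pow_apply,
      ContinuousMap.coe_mk, mul_pow, map_mul, map_pow, Complex.conj_ofReal, ← fourier_one_pow]
    ring
  simp_rw [h]
  rw [hopfMeasure, integral_prod_mul (fun s : unitInterval => ((√(s : ℝ) : ℂ) ^ (a + c) *
    (√(1 - (s : ℝ)) : ℂ) ^ (b + d))) (fun t : UnitAddCircle × UnitAddCircle =>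
      (fourier c t.1 * conj (fourier a t.1)) * (fourier d t.2 * conj (fourier b t.2))),
    integral_prod_mul (fun x : UnitAddCircle => fourier c x * conj (fourier a x))
      (fun x : UnitAddCircle => fourier d x * conj (fourier b x)),
    integral_fourier_mul_conj_fourier, integral_fourier_mul_conj_fourier]
  by_cases h1 : a = c
  · by_cases h2 : b = d
    · subst h1 h2
      simp only [if_true, mul_one]
      rw [← integral_unitInterval_pow_mul_pow]
      congr 1 with s
      rw [← two_mul, ← two_mul, pow_mul, pow_mul, ← Complex.ofReal_pow,
        ← Complex.ofReal_pow (√(1 - (s : ℝ))), Real.sq_sqrt s.2.1,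
        Real.sq_sqrt (sub_nonneg.2 s.2.2)]
      simp
    · simp [h1, h2]
  · simp [h1]

/-- The normalization of the monomial `z₁ᵃ z₂ᵇ` in the Hardy space. -/
noncomputable def hardyNorm (p : ℕ × ℕ) : ℝ := √((p.1 + p.2 + 1)! / (p.1 ! * p.2 !))

theorem hardyNorm_sq (p : ℕ × ℕ) :
    hardyNorm p ^ 2 * (p.1 ! * p.2 ! / (p.1 + p.2 + 1)!) = 1 := by
  rw [hardyNorm, Real.sq_sqrt (by positivity)]
  field_simp

/-- Normalized monomials in the complex coordinates. -/
noncomputable def hardyBasis (p : ℕ × ℕ) : Lp ℂ 2 hopfMeasure :=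
  ContinuousMap.toLp 2 hopfMeasure ℂ ((hardyNorm p : ℂ) • (hopfFst ^ p.1 * hopfSnd ^ p.2))

theorem orthonormal_hardyBasis : Orthonormal ℂ hardyBasis := by
  rw [orthonormal_iff_ite]
  intro p q
  rw [hardyBasis, hardyBasis, map_smul, map_smul, inner_smul_left, inner_smul_right,
    ContinuousMap.inner_toLp, integral_hopf_monomials, Complex.conj_ofReal]
  by_cases h : p = q
  · subst h
    simp only [if_true]
    rw [← mul_assoc, ← sq]
    exact_mod_cast hardyNorm_sq p
  · simp [h]

/-- The Hardy space, embedded into `L²` of the sphere. -/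
noncomputable def hardyEmbedding : lp (fun _ : ℕ × ℕ => ℂ) 2 →ₗᵢ[ℂ] Lp ℂ 2 hopfMeasure :=
  orthonormal_hardyBasis.orthogonalFamily.linearIsometry

theorem hardyEmbedding_ltwoBasis (p : ℕ × ℕ) :
    hardyEmbedding (ltwoBasis p) = hardyBasis p := by
  rw [hardyEmbedding, ltwoBasis, OrthogonalFamily.linearIsometry_apply_single]
  simp

/-- The weights of the shift given by multiplication by the first coordinate. -/
noncomputable def fstWeight (p : ℕ × ℕ) : ℝ := √((p.1 + 1) / (p.1 + p.2 + 2))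

/-- The weights of the shift given by multiplication by the second coordinate. -/
noncomputable def sndWeight (p : ℕ × ℕ) : ℝ := √((p.2 + 1) / (p.1 + p.2 + 2))

theorem fstWeight_mul_hardyNorm (p : ℕ × ℕ) :
    fstWeight p * hardyNorm (p.1 + 1, p.2) = hardyNorm p := by
  rw [fstWeight, hardyNorm, hardyNorm, ← Real.sqrt_mul (by positivity)]
  congr 1
  rw [show p.1 + 1 + p.2 + 1 = p.1 + p.2 + 1 + 1 by ring, Nat.factorial_succ, Nat.factorial_succ p.1]
  push_cast
  field_simp
  ring

theorem sndWeight_mul_hardyNorm (p : ℕ × ℕ) :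
    sndWeight p * hardyNorm (p.1, p.2 + 1) = hardyNorm p := by
  rw [sndWeight, hardyNorm, hardyNorm, ← Real.sqrt_mul (by positivity)]
  congr 1
  rw [show p.1 + (p.2 + 1) + 1 = p.1 + p.2 + 1 + 1 by ring, Nat.factorial_succ,
    Nat.factorial_succ p.2]
  push_cast
  field_simp
  ring

theorem mulOp_hopfFst (p : ℕ × ℕ) : mulOp hopfMeasure hopfFst (hardyEmbedding (ltwoBasis p)) =
    (fstWeight p : ℂ) • hardyEmbedding (ltwoBasis (p.1 + 1, p.2)) := by
  rw [hardyEmbedding_ltwoBasis, hardyEmbedding_ltwoBasis, hardyBasis, hardyBasis, mulOp_toLp,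
    ← map_smul, smul_smul, ← Complex.ofReal_mul, fstWeight_mul_hardyNorm]
  congr 1
  rw [mul_smul_comm, pow_succ']
  ring_nf

theorem mulOp_hopfSnd (p : ℕ × ℕ) : mulOp hopfMeasure hopfSnd (hardyEmbedding (ltwoBasis p)) =
    (sndWeight p : ℂ) • hardyEmbedding (ltwoBasis (p.1, p.2 + 1)) := by
  rw [hardyEmbedding_ltwoBasis, hardyEmbedding_ltwoBasis, hardyBasis, hardyBasis, mulOp_toLp,
    ← map_smul, smul_smul, ← Complex.ofReal_mul, sndWeight_mul_hardyNorm]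
  congr 1
  rw [mul_smul_comm, pow_succ']
  ring_nf

end HopfCoordinates

section SphereToeplitz

open scoped ComplexConjugate

/-- The unit quaternions. -/
abbrev QuatSphere : Type := Metric.sphere (0 : ℍ[ℝ]) 1

theorem quatSphere_sq_add_sq (q : QuatSphere) :
    q.1.re ^ 2 + q.1.imI ^ 2 + q.1.imJ ^ 2 + q.1.imK ^ 2 = 1 := by
  rw [← Quaternion.normSq_def', Quaternion.normSq_eq_norm_mul_self, norm_eq_of_mem_sphere q, one_mul]

/-- The quaternion with given components. -/
noncomputable def quatMk (a b c d : ℝ) : ℍ[ℝ] :=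
  Quaternion.linearIsometryEquivTuple.symm !₂[a, b, c, d]

theorem quatMk_mem_sphere {a b c d : ℝ} (h : a ^ 2 + b ^ 2 + c ^ 2 + d ^ 2 = 1) :
    quatMk a b c d ∈ Metric.sphere (0 : ℍ[ℝ]) 1 := by
  rw [mem_sphere_zero_iff_norm, ← sq_eq_sq₀ (norm_nonneg _) zero_le_one, sq,
    ← Quaternion.normSq_eq_norm_mul_self, Quaternion.normSq_def', one_pow]
  exact h

theorem continuous_quatMk {Y : Type*} [TopologicalSpace Y] {a b c d : Y → ℝ} (ha : Continuous a)
    (hb : Continuous b) (hc : Continuous c) (hd : Continuous d) :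
    Continuous fun y => quatMk (a y) (b y) (c y) (d y) := by
  have h : Continuous fun y => !₂[a y, b y, c y, d y] := by
    refine (PiLp.continuous_toLp 2 _).comp (continuous_pi fun i => ?_)
    fin_cases i <;> assumption
  exact Quaternion.linearIsometryEquivTuple.symm.continuous.comp h

/-- The coordinate `re + imI i` on the unit quaternions. -/
noncomputable def sphereFst : C(QuatSphere, ℂ) where
  toFun q := ⟨q.1.re, q.1.imI⟩
  continuous_toFun := by
    simp only [Complex.mk_eq_add_mul_I]
    have := Quaternion.continuous_re
    have := Quaternion.continuous_imI
    fun_prop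

/-- The coordinate `-imJ + imK i` on the unit quaternions. -/
noncomputable def sphereSnd : C(QuatSphere, ℂ) where
  toFun q := ⟨-q.1.imJ, q.1.imK⟩
  continuous_toFun := by
    simp only [Complex.mk_eq_add_mul_I]
    have := Quaternion.continuous_imJ
    have := Quaternion.continuous_imK
    fun_prop

theorem hopf_sq_add_sq (y : HopfDomain) :
    (hopfFst y).re ^ 2 + (hopfFst y).im ^ 2 + (-(hopfSnd y).re) ^ 2 + (hopfSnd y).im ^ 2 = 1 := by
  have h1 : ‖hopfFst y‖ ^ 2 = y.1 := by
    simp [hopfFst, Real.sq_sqrt y.1.2.1, Circle.norm_coe]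
  have h2 : ‖hopfSnd y‖ ^ 2 = 1 - y.1 := by
    simp [hopfSnd, Real.sq_sqrt (sub_nonneg.2 y.1.2.2), Circle.norm_coe]
  rw [Complex.sq_norm, Complex.normSq_apply] at h1 h2
  linarith

/-- Hopf coordinates on the unit quaternions. -/
noncomputable def hopfMap : C(HopfDomain, QuatSphere) where
  toFun y := ⟨_, quatMk_mem_sphere (hopf_sq_add_sq y)⟩
  continuous_toFun := by
    refine Continuous.subtype_mk (continuous_quatMk (Complex.continuous_re.comp (map_continuous _))
      (Complex.continuous_im.comp (map_continuous _))
      (Complex.continuous_re.comp (map_continuous _)).neg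
      (Complex.continuous_im.comp (map_continuous _))) _

theorem sphereFst_comp_hopfMap : sphereFst.comp hopfMap = hopfFst := by
  ext y; rfl

theorem sphereSnd_comp_hopfMap : sphereSnd.comp hopfMap = hopfSnd := by
  ext y
  exact Complex.ext (neg_neg _) rfl

/-- Multiplication by continuous functions on the sphere. -/
noncomputable def sphereRep :
    C(QuatSphere, ℂ) →⋆ₐ[ℂ] (MeasureTheory.Lp ℂ 2 hopfMeasure →L[ℂ] MeasureTheory.Lp ℂ 2 hopfMeasure) :=
  (mulOp hopfMeasure).comp (ContinuousMap.compStarAlgHom' ℂ ℂ hopfMap)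

theorem sphereRep_fst : sphereRep sphereFst = mulOp hopfMeasure hopfFst := by
  rw [← sphereFst_comp_hopfMap]; rfl

theorem sphereRep_snd : sphereRep sphereSnd = mulOp hopfMeasure hopfSnd := by
  rw [← sphereSnd_comp_hopfMap]; rfl

theorem finite_setOf_lt_of_le {d : ℕ × ℕ → ℝ} (hd : ∀ p, d p ≤ 1 / (p.1 + p.2 + 2))
    {ε : ℝ} (hε : 0 < ε) : {p | ε < d p}.Finite := by
  obtain ⟨n, hn⟩ := exists_nat_gt (1 / ε)
  refine (Set.finite_Iic (n, n)).subset fun p hp => ?_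
  have h1 : ε < 1 / (p.1 + p.2 + 2) := lt_of_lt_of_le hp (hd p)
  rw [lt_div_iff₀ (by positivity)] at h1
  rw [div_lt_iff₀ hε] at hn
  have h2 : (p.1 + p.2 + 2 : ℝ) < n := lt_of_mul_lt_mul_left (by linarith) hε.le
  have h3 : p.1 + p.2 + 2 < n := by exact_mod_cast h2
  exact ⟨by simp only; omega, by simp only; omega⟩

theorem essInvariantSubalgebra_sphere :
    essInvariantSubalgebra hardyEmbedding sphereRep = ⊤ := by
  have hnormal (f : C(QuatSphere, ℂ)) : IsStarNormal (sphereRep f) := by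
    refine ⟨?_⟩
    rw [← map_star]
    exact (Commute.all (star f) f).map sphereRep
  refine essInvariantSubalgebra_eq_top _ _ (s := {sphereFst, sphereSnd}) ?_ ?_ ?_
  · intro x y hxy
    by_contra! h
    have h1 := h sphereFst (by simp)
    have h2 := h sphereSnd (by simp)
    simp only [sphereFst, sphereSnd, ContinuousMap.coe_mk, Complex.mk.injEq, neg_inj] at h1 h2
    exact hxy (Subtype.ext (QuaternionAlgebra.ext h1.1 h1.2 h2.1 h2.2))
  · rintro f (rfl | rfl)
    · rw [sphereRep_fst, defect_eq_zero mulOp_hopfFst]; exact zero_mem _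
    · rw [sphereRep_snd, defect_eq_zero mulOp_hopfSnd]; exact zero_mem _
  · rintro f (rfl | rfl)
    · have h := hnormal sphereFst
      rw [map_star]
      rw [sphereRep_fst] at h ⊢
      refine defect_star_mem_approximable (v := fun p => p.1 / (p.1 + p.2 + 1)) ?_ mulOp_hopfFst
        h ?_ ?_ fun ε hε => finite_setOf_lt_of_le (fun p => ?_) hε
      · rintro ⟨a, b⟩ ⟨c, d⟩ h; simpa using h
      · intro p; rw [fstWeight, Real.sq_sqrt (by positivity)]; push_cast; congr 1; ring
      · rintro ⟨a, b⟩ h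
        cases a with
        | zero => simp
        | succ a => exact absurd ⟨(a, b), rfl⟩ h
      · rw [fstWeight, Real.sq_sqrt (by positivity), div_sub_div _ _ (by positivity) (by positivity),
          div_le_div_iff₀ (by positivity) (by positivity)]
        have : (0 : ℝ) ≤ p.1 * (p.1 + p.2 + 2) := by positivity
        nlinarith
    · have h := hnormal sphereSnd
      rw [map_star]
      rw [sphereRep_snd] at h ⊢
      refine defect_star_mem_approximable (v := fun p => p.2 / (p.1 + p.2 + 1)) ?_ mulOp_hopfSnd
        h ?_ ?_ fun ε hε => finite_setOf_lt_of_le (fun p => ?_) hε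
      · rintro ⟨a, b⟩ ⟨c, d⟩ h; simpa using h
      · intro p; rw [sndWeight, Real.sq_sqrt (by positivity)]; push_cast; congr 1; ring
      · rintro ⟨a, b⟩ h
        cases b with
        | zero => simp
        | succ b => exact absurd ⟨(a, b), rfl⟩ h
      · rw [sndWeight, Real.sq_sqrt (by positivity), div_sub_div _ _ (by positivity) (by positivity),
          div_le_div_iff₀ (by positivity) (by positivity)]
        have : (0 : ℝ) ≤ p.2 * (p.1 + p.2 + 2) := by positivity
        nlinarith

/-- The Toeplitz quantization of continuous functions on the unit quaternions. -/
noncomputable def sphereToeplitz : ToeplitzMap QuatSphere (lp (fun _ : ℕ × ℕ => ℂ) 2) :=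
  ToeplitzMap.ofCompression hardyEmbedding sphereRep essInvariantSubalgebra_sphere

theorem sphereToeplitz_fst_ltwoBasis (p : ℕ × ℕ) : sphereToeplitz.toLin sphereFst (ltwoBasis p) =
    (fstWeight p : ℂ) • ltwoBasis (p.1 + 1, p.2) := by
  change compr hardyEmbedding (sphereRep sphereFst) _ = _
  rw [sphereRep_fst, compr_ltwoBasis mulOp_hopfFst]

theorem sphereToeplitz_snd_ltwoBasis (p : ℕ × ℕ) : sphereToeplitz.toLin sphereSnd (ltwoBasis p) =
    (sndWeight p : ℂ) • ltwoBasis (p.1, p.2 + 1) := by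
  change compr hardyEmbedding (sphereRep sphereSnd) _ = _
  rw [sphereRep_snd, compr_ltwoBasis mulOp_hopfSnd]

theorem sphereToeplitz_star (f : C(QuatSphere, ℂ)) :
    sphereToeplitz.toLin (star f) = ContinuousLinearMap.adjoint (sphereToeplitz.toLin f) := by
  change compr hardyEmbedding (sphereRep (star f)) =
    ContinuousLinearMap.adjoint (compr hardyEmbedding (sphereRep f))
  rw [map_star, compr_star]

end SphereToeplitz

section SphereIndex

open ContinuousLinearMap

theorem fstWeight_sq_add_sndWeight_sq (p : ℕ × ℕ) : fstWeight p ^ 2 + sndWeight p ^ 2 = 1 := by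
  rw [fstWeight, sndWeight, Real.sq_sqrt (by positivity), Real.sq_sqrt (by positivity),
    ← add_div, div_eq_one_iff_eq (by positivity)]
  ring

theorem fstWeight_pos (p : ℕ × ℕ) : 0 < fstWeight p := by
  unfold fstWeight; positivity

theorem sndWeight_pos (p : ℕ × ℕ) : 0 < sndWeight p := by
  unfold sndWeight; positivity

theorem fstWeight_mul_sndWeight (a b : ℕ) :
    fstWeight (a, b) * sndWeight (a + 1, b) = sndWeight (a, b) * fstWeight (a, b + 1) := by
  simp only [fstWeight, sndWeight]
  rw [← Real.sqrt_mul (by positivity), ← Real.sqrt_mul (by positivity)]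
  congr 1
  push_cast
  rw [div_mul_div_comm, div_mul_div_comm]
  congr 1 <;> ring

theorem fstWeight_mul_sndWeight_self (a b : ℕ) : fstWeight (a, b) * sndWeight (a, b) =
    sndWeight (a + 1, b) * fstWeight (a, b + 1) * ((a + b + 3) / (a + b + 2)) := by
  simp only [fstWeight, sndWeight]
  rw [← Real.sqrt_mul (by positivity), ← Real.sqrt_mul (by positivity)]
  rw [← Real.sqrt_sq (show (0 : ℝ) ≤ (a + b + 3) / (a + b + 2) by positivity),
    ← Real.sqrt_mul (by positivity)]
  congr 1
  push_cast
  field_simp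
  ring

theorem one_sub_fstWeight_sq (a b : ℕ) : 1 - fstWeight (a, b) ^ 2 =
    sndWeight (a + 1, b) ^ 2 * ((a + b + 3) / (a + b + 2)) := by
  rw [fstWeight, sndWeight, Real.sq_sqrt (by positivity), Real.sq_sqrt (by positivity)]
  push_cast
  field_simp
  ring

theorem one_sub_sndWeight_sq (a b : ℕ) : 1 - sndWeight (a, b) ^ 2 =
    fstWeight (a, b + 1) ^ 2 * ((a + b + 3) / (a + b + 2)) := by
  rw [fstWeight, sndWeight, Real.sq_sqrt (by positivity), Real.sq_sqrt (by positivity)]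
  push_cast
  field_simp
  ring

local notation "ℓ²" => lp (fun _ : ℕ × ℕ => ℂ) 2
local notation "T₁" => sphereToeplitz.toLin sphereFst
local notation "T₂" => sphereToeplitz.toLin sphereSnd

theorem fstShift_succ (x : ℓ²) (a b : ℕ) : T₁ x (a + 1, b) = fstWeight (a, b) * x (a, b) :=
  weightedShift_apply (s := fun p : ℕ × ℕ => (p.1 + 1, p.2))
    (by rintro ⟨a, b⟩ ⟨c, d⟩ h; simpa using h) sphereToeplitz_fst_ltwoBasis x (a, b)

theorem fstShift_zero (x : ℓ²) (b : ℕ) : T₁ x (0, b) = 0 :=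
  weightedShift_apply_of_notMem (s := fun p : ℕ × ℕ => (p.1 + 1, p.2))
    sphereToeplitz_fst_ltwoBasis x (by simp)

theorem sndShift_succ (x : ℓ²) (a b : ℕ) : T₂ x (a, b + 1) = sndWeight (a, b) * x (a, b) :=
  weightedShift_apply (s := fun p : ℕ × ℕ => (p.1, p.2 + 1))
    (by rintro ⟨a, b⟩ ⟨c, d⟩ h; simpa using h) sphereToeplitz_snd_ltwoBasis x (a, b)

theorem sndShift_zero (x : ℓ²) (a : ℕ) : T₂ x (a, 0) = 0 :=
  weightedShift_apply_of_notMem (s := fun p : ℕ × ℕ => (p.1, p.2 + 1))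
    sphereToeplitz_snd_ltwoBasis x (by simp)

theorem adjoint_fstShift_apply (x : ℓ²) (a b : ℕ) :
    adjoint T₁ x (a, b) = fstWeight (a, b) * x (a + 1, b) :=
  adjoint_weightedShift_apply sphereToeplitz_fst_ltwoBasis x (a, b)

theorem adjoint_sndShift_apply (x : ℓ²) (a b : ℕ) :
    adjoint T₂ x (a, b) = sndWeight (a, b) * x (a, b + 1) :=
  adjoint_weightedShift_apply sphereToeplitz_snd_ltwoBasis x (a, b)

theorem exists_diagonal_apply (z : ℓ²) :
    ∃ y : ℓ², ∀ a b : ℕ, y (a, b) = ((a + b + 1) / (a + b) : ℝ) * z (a, b) := by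
  have hz : Memℓp (fun p : ℕ × ℕ => ((p.1 + p.2 + 1) / (p.1 + p.2) : ℝ) * z p) 2 := by
    refine memℓp_gen ?_
    have h := (lp.memℓp z).summable (by norm_num)
    refine (h.mul_left 4).of_nonneg_of_le (fun p => by positivity) fun p => ?_
    have h2 : ‖(((p.1 + p.2 + 1) / (p.1 + p.2) : ℝ) : ℂ)‖ ≤ 2 := by
      rw [Complex.norm_real, Real.norm_of_nonneg (by positivity)]
      rcases Nat.eq_zero_or_pos (p.1 + p.2) with h0 | h0
      · have : (p.1 + p.2 : ℝ) = 0 := by exact_mod_cast h0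
        rw [this]; norm_num
      · have : (1 : ℝ) ≤ p.1 + p.2 := by exact_mod_cast h0
        rw [div_le_iff₀ (by positivity)]; linarith
    have h3 := pow_le_pow_left₀ (norm_nonneg _) h2 2
    rw [norm_mul]
    simp only [ENNReal.toReal_ofNat, Real.rpow_ofNat, mul_pow]
    gcongr
    linarith
  exact ⟨⟨_, hz⟩, fun a b => rfl⟩

theorem exists_sphereToeplitz_quaternion_eq (u v : ℓ²) :
    ∃ x y : ℓ², T₁ x - adjoint T₂ y = u ∧ T₂ x + adjoint T₁ y = v := by
  obtain ⟨y, hy⟩ := exists_diagonal_apply (T₁ v - T₂ u)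
  refine ⟨adjoint T₁ u + adjoint T₂ v, y, ?_, ?_⟩
  · ext ⟨a, b⟩
    simp only [lp.coeFn_sub, Pi.sub_apply, adjoint_sndShift_apply, hy, sndShift_succ]
    cases a with
    | zero =>
      rw [fstShift_zero, fstShift_zero]
      have h : sndWeight (0, b) ^ 2 * ((b + 2) / (b + 1)) = 1 := by
        rw [sndWeight, Real.sq_sqrt (by positivity)]
        push_cast
        field_simp
        ring
      have h1 := congrArg ((↑) : ℝ → ℂ) h
      push_cast at h1 ⊢
      linear_combination u (0, b) * h1
    | succ a =>
      rw [fstShift_succ, fstShift_succ]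
      simp only [lp.coeFn_add, Pi.add_apply, adjoint_fstShift_apply, adjoint_sndShift_apply]
      have h1 := congrArg ((↑) : ℝ → ℂ) (one_sub_fstWeight_sq a b)
      have h2 := congrArg ((↑) : ℝ → ℂ) (fstWeight_mul_sndWeight_self a b)
      push_cast at h1 h2 ⊢
      linear_combination (-u (a + 1, b)) * h1 + v (a, b + 1) * h2
  · ext ⟨a, b⟩
    simp only [lp.coeFn_add, lp.coeFn_sub, Pi.add_apply, Pi.sub_apply, adjoint_fstShift_apply, hy,
      fstShift_succ]
    cases b with
    | zero =>
      rw [sndShift_zero, sndShift_zero]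
      have h : fstWeight (a, 0) ^ 2 * ((a + 2) / (a + 1)) = 1 := by
        rw [fstWeight, Real.sq_sqrt (by positivity)]
        push_cast
        field_simp
        ring
      have h1 := congrArg ((↑) : ℝ → ℂ) h
      push_cast at h1 ⊢
      linear_combination v (a, 0) * h1
    | succ b =>
      rw [sndShift_succ, sndShift_succ]
      simp only [lp.coeFn_add, Pi.add_apply, adjoint_fstShift_apply, adjoint_sndShift_apply]
      have h1 := congrArg ((↑) : ℝ → ℂ) (one_sub_sndWeight_sq a b)
      have h2 := congrArg ((↑) : ℝ → ℂ) (fstWeight_mul_sndWeight_self a b)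
      push_cast at h1 h2 ⊢
      linear_combination (-v (a, b + 1)) * h1 + u (a + 1, b) * h2

theorem sphereToeplitz_quaternion_eq_zero {x y : ℓ²} (h1 : T₁ x - adjoint T₂ y = 0)
    (h2 : T₂ x + adjoint T₁ y = 0) : x = 0 ∧ y = y (0, 0) • ltwoBasis (0, 0) := by
  have hx : x = 0 := by
    ext ⟨a, b⟩
    have h1' := congrArg (fun f : ℓ² => f (a + 1, b)) h1
    have h2' := congrArg (fun f : ℓ² => f (a, b + 1)) h2
    simp only [lp.coeFn_sub, Pi.sub_apply, lp.coeFn_add, Pi.add_apply, fstShift_succ,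
      sndShift_succ, adjoint_fstShift_apply, adjoint_sndShift_apply, lp.coeFn_zero,
      Pi.zero_apply] at h1' h2' ⊢
    have h3 := congrArg ((↑) : ℝ → ℂ) (fstWeight_sq_add_sndWeight_sq (a, b))
    have h4 := congrArg ((↑) : ℝ → ℂ) (fstWeight_mul_sndWeight a b)
    push_cast at h3 h4
    linear_combination (-x (a, b)) * h3 + fstWeight (a, b) * h1' + sndWeight (a, b) * h2' +
      y (a + 1, b + 1) * h4
  subst hx
  refine ⟨rfl, ?_⟩
  ext ⟨a, b⟩
  have h1' (a b : ℕ) := congrArg (fun f : ℓ² => f (a, b)) h1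
  have h2' (a b : ℕ) := congrArg (fun f : ℓ² => f (a, b)) h2
  simp only [map_zero, zero_sub, zero_add, lp.coeFn_neg, Pi.neg_apply, adjoint_fstShift_apply,
    adjoint_sndShift_apply, lp.coeFn_zero, Pi.zero_apply, neg_eq_zero, mul_eq_zero,
    Complex.ofReal_eq_zero, (fstWeight_pos _).ne', (sndWeight_pos _).ne', false_or] at h1' h2'
  simp only [lp.coeFn_smul, Pi.smul_apply, ltwoBasis_apply, smul_eq_mul]
  cases a with
  | succ a => simp [h2']
  | zero =>
    cases b with
    | succ b => simp [h1']
    | zero => simp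

end SphereIndex

section QuaternionicDegree

/-- The representation of quaternions by complex `2 × 2` matrices. -/
noncomputable def quatRep : ℍ[ℝ] →+* Matrix (Fin 2) (Fin 2) ℂ where
  toFun q := !![⟨q.re, q.imI⟩, ⟨q.imJ, q.imK⟩; ⟨-q.imJ, q.imK⟩, ⟨q.re, -q.imI⟩]
  map_one' := by
    ext i j : 2
    fin_cases i <;> fin_cases j <;> simp [Complex.ext_iff]
  map_zero' := by
    ext i j : 2
    fin_cases i <;> fin_cases j <;> simp [Complex.ext_iff]
  map_add' p q := by
    ext i j : 2
    fin_cases i <;> fin_cases j <;> simp [Complex.ext_iff]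
    all_goals ring
  map_mul' p q := by
    ext i j : 2
    fin_cases i <;> fin_cases j <;> simp [Complex.ext_iff, Matrix.mul_apply]
    all_goals constructor <;> ring

theorem quatRep_apply (q : ℍ[ℝ]) :
    quatRep q = !![⟨q.re, q.imI⟩, ⟨q.imJ, q.imK⟩; ⟨-q.imJ, q.imK⟩, ⟨q.re, -q.imI⟩] := rfl

theorem continuous_quatRep : Continuous quatRep := by
  have h1 := Quaternion.continuous_re
  have h2 := Quaternion.continuous_imI
  have h3 := Quaternion.continuous_imJ
  have h4 := Quaternion.continuous_imK
  refine continuous_matrix fun i j => ?_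
  simp only [quatRep_apply, Complex.mk_eq_add_mul_I]
  fin_cases i <;> fin_cases j <;> simp <;> fun_prop

variable {k : Type*} [Fintype k] [DecidableEq k]

/-- The representation of quaternionic matrices by complex matrices. -/
noncomputable def quatMatrixRep : Matrix k k ℍ[ℝ] →+* Matrix (k × Fin 2) (k × Fin 2) ℂ :=
  (Matrix.compRingEquiv k (Fin 2) ℂ).toRingHom.comp quatRep.mapMatrix

theorem quatMatrixRep_apply (A : Matrix k k ℍ[ℝ]) (p r : k × Fin 2) :
    quatMatrixRep A p r = quatRep (A p.1 r.1) p.2 r.2 := rfl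

theorem continuous_quatMatrixRep_apply (p r : k × Fin 2) :
    Continuous fun A : Matrix k k ℍ[ℝ] => quatMatrixRep A p r :=
  (continuous_quatRep.comp (continuous_id.matrix_elem p.1 r.1)).matrix_elem p.2 r.2

/-- The complex matrix symbol of a map into unitary quaternionic matrices. -/
noncomputable def quatSymbol {X : Type*} [TopologicalSpace X]
    (g : C(X, unitary (Matrix k k ℍ[ℝ]))) : Matrix (k × Fin 2) (k × Fin 2) C(X, ℂ) :=
  Matrix.of fun p r => ⟨fun x => quatMatrixRep (g x).1 p r,
    (continuous_quatMatrixRep_apply p r).comp (continuous_subtype_val.comp (map_continuous g))⟩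

variable {X : Type*} [TopologicalSpace X]

theorem quatSymbol_apply (g : C(X, unitary (Matrix k k ℍ[ℝ]))) (p r : k × Fin 2) (x : X) :
    quatSymbol g p r x = quatMatrixRep (g x).1 p r := rfl

theorem quatSymbol_one : quatSymbol (1 : C(X, unitary (Matrix k k ℍ[ℝ]))) = 1 := by
  ext p r x
  rw [quatSymbol_apply, ContinuousMap.one_apply, OneMemClass.coe_one, map_one, Matrix.one_apply,
    Matrix.one_apply]
  split_ifs <;> rfl

theorem quatSymbol_mul (g h : C(X, unitary (Matrix k k ℍ[ℝ]))) :
    quatSymbol (g * h) = quatSymbol g * quatSymbol h := by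
  ext p r x
  rw [quatSymbol_apply, ContinuousMap.mul_apply, Submonoid.coe_mul, map_mul, Matrix.mul_apply,
    Matrix.mul_apply]
  simp [quatSymbol_apply]

theorem isUnit_quatSymbol (g : C(X, unitary (Matrix k k ℍ[ℝ]))) : IsUnit (quatSymbol g) :=
  IsUnit.of_mul_eq_one (quatSymbol g⁻¹) (by
    rw [← quatSymbol_mul, mul_inv_cancel, quatSymbol_one])

/-- The degree of a map from the unit quaternions into unitary quaternionic matrices. -/
noncomputable def quatDeg (g : C(QuatSphere, unitary (Matrix k k ℍ[ℝ]))) : ℤ :=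
  sphereToeplitz.deg (quatSymbol g)

theorem quatDeg_mul (g h : C(QuatSphere, unitary (Matrix k k ℍ[ℝ]))) :
    quatDeg (g * h) = quatDeg g + quatDeg h := by
  rw [quatDeg, quatSymbol_mul]
  exact sphereToeplitz.deg_mul (isUnit_quatSymbol g) (isUnit_quatSymbol h)

theorem quatDeg_const (A : unitary (Matrix k k ℍ[ℝ])) :
    quatDeg (ContinuousMap.const QuatSphere A) = 0 := by
  have hA : IsUnit (quatMatrixRep A.1) :=
    IsUnit.of_mul_eq_one (quatMatrixRep (star A.1)) (by
      rw [← map_mul, Unitary.mul_star_self_of_mem A.2, map_one])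
  have h : quatSymbol (ContinuousMap.const QuatSphere A) =
      (quatMatrixRep A.1).map (algebraMap ℂ C(QuatSphere, ℂ)) := by
    ext p r x
    rfl
  rw [quatDeg, h]
  exact sphereToeplitz.deg_const hA

theorem quatDeg_congr {g h : C(QuatSphere, unitary (Matrix k k ℍ[ℝ]))}
    (H : g.Homotopic h) : quatDeg g = quatDeg h := by
  obtain ⟨H⟩ := H
  have hc : Continuous fun t => quatSymbol (H.curry t) := by
    refine continuous_matrix fun p r => ?_
    let K : C(unitInterval × QuatSphere, ℂ) :=
      ⟨fun x => quatMatrixRep (H x).1 p r, (continuous_quatMatrixRep_apply p r).comp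
        (continuous_subtype_val.comp (map_continuous H))⟩
    exact map_continuous K.curry
  have h1 := sphereToeplitz.deg_eq_of_continuous hc (fun t => isUnit_quatSymbol _) 0 1
  have h0 : H.curry 0 = g := by ext1 x; exact H.apply_zero x
  have h2 : H.curry 1 = h := by ext1 x; exact H.apply_one x
  rwa [h0, h2] at h1

end QuaternionicDegree

section ScalarDegree

variable {k : Type*} [Fintype k] [DecidableEq k]

theorem scalar_mem_unitary (q : QuatSphere) :
    Matrix.scalar k q.1 ∈ unitary (Matrix k k ℍ[ℝ]) := by
  have h1 : star q.1 * q.1 = 1 := by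
    rw [Quaternion.star_mul_self, Quaternion.normSq_eq_norm_mul_self, norm_eq_of_mem_sphere]; simp
  have h2 : q.1 * star q.1 = 1 := by
    rw [Quaternion.self_mul_star, Quaternion.normSq_eq_norm_mul_self, norm_eq_of_mem_sphere]; simp
  rw [Unitary.mem_iff]
  simp [Matrix.scalar_apply, star_eq_conjTranspose, diagonal_conjTranspose, h1, h2]

/-- Scalar multiples of the identity matrix by unit quaternions. -/
noncomputable def quatScalar : C(QuatSphere, unitary (Matrix k k ℍ[ℝ])) where
  toFun q := ⟨_, scalar_mem_unitary q⟩
  continuous_toFun := by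
    refine Continuous.subtype_mk ?_ _
    simp only [Matrix.scalar_apply]
    fun_prop

local notation "ℓ²" => lp (fun _ : ℕ × ℕ => ℂ) 2

theorem op_quatSymbol_quatScalar_apply (x : k × Fin 2 → ℓ²) (i : k) :
    sphereToeplitz.op (quatSymbol quatScalar) x (i, 0) =
      sphereToeplitz.toLin sphereFst (x (i, 0)) -
        ContinuousLinearMap.adjoint (sphereToeplitz.toLin sphereSnd) (x (i, 1)) ∧
    sphereToeplitz.op (quatSymbol quatScalar) x (i, 1) =
      sphereToeplitz.toLin sphereSnd (x (i, 0)) +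
        ContinuousLinearMap.adjoint (sphereToeplitz.toLin sphereFst) (x (i, 1)) := by
  have hne {i j : k} (h : i ≠ j) (a b : Fin 2) :
      quatSymbol (quatScalar (k := k)) (i, a) (j, b) = 0 := by
    ext q
    simp [quatSymbol_apply, quatMatrixRep_apply, quatScalar, Matrix.diagonal_apply_ne _ h]
  have h00 : quatSymbol (quatScalar (k := k)) (i, 0) (i, 0) = sphereFst := by
    ext q
    simp [quatSymbol_apply, quatMatrixRep_apply, quatScalar, quatRep_apply, sphereFst]
  have h01 : quatSymbol (quatScalar (k := k)) (i, 0) (i, 1) = -star sphereSnd := by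
    ext q
    change _ = -star (sphereSnd q)
    simp [quatSymbol_apply, quatMatrixRep_apply, quatScalar, quatRep_apply, sphereSnd,
      Complex.ext_iff]
  have h10 : quatSymbol (quatScalar (k := k)) (i, 1) (i, 0) = sphereSnd := by
    ext q
    simp [quatSymbol_apply, quatMatrixRep_apply, quatScalar, quatRep_apply, sphereSnd]
  have h11 : quatSymbol (quatScalar (k := k)) (i, 1) (i, 1) = star sphereFst := by
    ext q
    change _ = star (sphereFst q)
    simp [quatSymbol_apply, quatMatrixRep_apply, quatScalar, quatRep_apply, sphereFst,
      Complex.ext_iff]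
  simp only [ToeplitzMap.op, matOp_apply, Matrix.map_apply, Fintype.sum_prod_type,
    Fin.sum_univ_two]
  constructor
  · rw [Finset.sum_eq_single i (fun j _ hj => by simp [hne hj.symm]) (by simp), h00, h01, map_neg,
      sphereToeplitz_star]
    simp [sub_eq_add_neg]
  · rw [Finset.sum_eq_single i (fun j _ hj => by simp [hne hj.symm]) (by simp), h10, h11,
      sphereToeplitz_star]

theorem quatDeg_quatScalar : quatDeg (quatScalar (k := k)) = Fintype.card k := by
  let T := (sphereToeplitz.op (quatSymbol (quatScalar (k := k)))).toLinearMap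
  have hsurj : Function.Surjective T := by
    intro y
    choose u v huv using fun i : k => exists_sphereToeplitz_quaternion_eq (y (i, 0)) (y (i, 1))
    let x : k × Fin 2 → ℓ² := fun p => ![u p.1, v p.1] p.2
    refine ⟨x, ?_⟩
    ext1 ⟨i, a⟩
    have h := op_quatSymbol_quatScalar_apply x i
    fin_cases a
    · exact h.1.trans (huv i).1
    · exact h.2.trans (huv i).2
  let φ : (k → ℂ) →ₗ[ℂ] (k × Fin 2 → ℓ²) :=
    { toFun := fun c p => ![0, c p.1 • ltwoBasis (0, 0)] p.2
      map_add' := fun c d => by ext1 ⟨i, a⟩; fin_cases a <;> simp [add_smul]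
      map_smul' := fun r c => by ext1 ⟨i, a⟩; fin_cases a <;> simp [mul_smul] }
  have hφ : Function.Injective φ := by
    intro c d h
    ext i
    have := congrArg (fun f : ℓ² => f (0, 0)) (congrFun h (i, 1))
    simpa [φ, ltwoBasis_apply] using this
  have hker : LinearMap.ker T = LinearMap.range φ := by
    ext x
    rw [LinearMap.mem_ker, LinearMap.mem_range]
    constructor
    · intro hx
      refine ⟨fun i => x (i, 1) (0, 0), ?_⟩
      ext1 ⟨i, a⟩
      have h := op_quatSymbol_quatScalar_apply x i
      have h0 := sphereToeplitz_quaternion_eq_zero (h.1.symm.trans (congrFun hx (i, 0)))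
        (h.2.symm.trans (congrFun hx (i, 1)))
      fin_cases a
      · exact h0.1.symm
      · exact h0.2.symm
    · rintro ⟨c, rfl⟩
      ext1 ⟨i, a⟩
      have h := op_quatSymbol_quatScalar_apply (φ c) i
      have h1 : ContinuousLinearMap.adjoint (sphereToeplitz.toLin sphereFst)
          (ltwoBasis (0, 0)) = 0 := by
        ext ⟨a, b⟩; rw [adjoint_fstShift_apply]; simp [ltwoBasis_apply]
      have h2 : ContinuousLinearMap.adjoint (sphereToeplitz.toLin sphereSnd)
          (ltwoBasis (0, 0)) = 0 := by
        ext ⟨a, b⟩; rw [adjoint_sndShift_apply]; simp [ltwoBasis_apply]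
      fin_cases a
      · exact h.1.trans (by simp [φ, h2])
      · exact h.2.trans (by simp [φ, h1])
  change T.index = _
  rw [LinearMap.index_of_surjective hsurj, hker, LinearMap.finrank_range_of_inj hφ,
    Module.finrank_fintype_fun_eq_card]

end ScalarDegree

section Pinch

/-- Normalization of a nowhere vanishing quaternion-valued map. -/
noncomputable def quatNormalize {X : Type*} [TopologicalSpace X] (h : C(X, ℍ[ℝ]))
    (h0 : ∀ x, h x ≠ 0) : C(X, QuatSphere) where
  toFun x := ⟨‖h x‖⁻¹ • h x, by
    rw [mem_sphere_zero_iff_norm, norm_smul, norm_inv, norm_norm,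
      inv_mul_cancel₀ (norm_ne_zero_iff.2 (h0 x))]⟩
  continuous_toFun := by
    refine Continuous.subtype_mk ?_ _
    exact (h.continuous.norm.inv₀ fun x => norm_ne_zero_iff.2 (h0 x)).smul h.continuous

theorem coe_quatNormalize {X : Type*} [TopologicalSpace X] (h : C(X, ℍ[ℝ]))
    (h0 : ∀ x, h x ≠ 0) (x : X) : (quatNormalize h h0 x : ℍ[ℝ]) = ‖h x‖⁻¹ • h x := rfl

/-- The straight-line deformation of the unit quaternions from the identity to a map that is
constant on a hemisphere. -/
noncomputable def pinchAux : C(unitInterval × QuatSphere, ℍ[ℝ]) where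
  toFun x := (1 - x.1 : ℝ) • x.2.1 + (x.1 : ℝ) •
    (((1 - 2 * max 0 (-x.2.1.re) : ℝ) : ℍ[ℝ]) + max 0 (-x.2.1.re) • x.2.1.im)
  continuous_toFun := by
    have h1 := Quaternion.continuous_re
    have h2 := Quaternion.continuous_im
    have h3 : Continuous fun r : ℝ => (r : ℍ[ℝ]) := Quaternion.continuous_coe
    fun_prop

theorem pinchAux_apply (t : unitInterval) (q : QuatSphere) : pinchAux (t, q) =
    (1 - t : ℝ) • q.1 + (t : ℝ) •
      (((1 - 2 * max 0 (-q.1.re) : ℝ) : ℍ[ℝ]) + max 0 (-q.1.re) • q.1.im) := rfl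

theorem pinchAux_ne_zero (x : unitInterval × QuatSphere) : pinchAux x ≠ 0 := by
  obtain ⟨t, q⟩ := x
  intro h
  have ht0 := t.2.1
  have ht1 := t.2.2
  have hq : q.1.re ^ 2 + q.1.imI ^ 2 + q.1.imJ ^ 2 + q.1.imK ^ 2 = 1 :=
    quatSphere_sq_add_sq q
  rw [pinchAux_apply] at h
  have hre := congrArg QuaternionAlgebra.re h
  have hi := congrArg QuaternionAlgebra.imI h
  have hj := congrArg QuaternionAlgebra.imJ h
  have hk := congrArg QuaternionAlgebra.imK h
  simp at hre hi hj hk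
  rcases le_total 0 q.1.re with h0 | h0
  · rw [max_eq_left (by linarith)] at *
    have ht : (t : ℝ) = 0 := by nlinarith
    simp only [ht, sub_zero, one_mul, zero_mul, add_zero] at hre hi hj hk
    rw [hre, hi, hj, hk] at hq
    norm_num at hq
  · rw [max_eq_right (by linarith)] at *
    have hc : (1 - t : ℝ) + t * -q.1.re ≠ 0 := by
      intro hc
      have h1 : 0 ≤ (t : ℝ) * -q.1.re := mul_nonneg ht0 (by linarith)
      have h2 : (t : ℝ) = 1 := by linarith
      rw [h2] at hc hre
      linarith
    have hi' : q.1.imI = 0 := (mul_eq_zero.1 (by linarith)).resolve_left hc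
    have hj' : q.1.imJ = 0 := (mul_eq_zero.1 (by linarith)).resolve_left hc
    have hk' : q.1.imK = 0 := (mul_eq_zero.1 (by linarith)).resolve_left hc
    have hr : q.1.re = -1 := by
      rw [hi', hj', hk'] at hq
      nlinarith
    rw [hr] at hre
    linarith

/-- A self-map of the unit quaternions homotopic to the identity that is constant on the
hemisphere of nonnegative real part. -/
noncomputable def pinchPos : C(QuatSphere, QuatSphere) :=
  (quatNormalize pinchAux pinchAux_ne_zero).comp
    ((ContinuousMap.const _ 1).prodMk (ContinuousMap.id _))

theorem homotopic_pinchPos : (ContinuousMap.id QuatSphere).Homotopic pinchPos := by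
  refine ⟨⟨quatNormalize pinchAux pinchAux_ne_zero, fun q => ?_, fun q => rfl⟩⟩
  ext1
  change (quatNormalize pinchAux pinchAux_ne_zero (0, q) : ℍ[ℝ]) = _
  rw [coe_quatNormalize, pinchAux_apply]
  simp

theorem pinchPos_eq_one {q : QuatSphere} (hq : 0 ≤ q.1.re) : pinchPos q = 1 := by
  ext1
  change (quatNormalize pinchAux pinchAux_ne_zero (1, q) : ℍ[ℝ]) = 1
  rw [coe_quatNormalize, pinchAux_apply, max_eq_left (by linarith)]
  simp

/-- A self-map of the unit quaternions homotopic to the identity that is constant on the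
hemisphere of nonpositive real part. -/
noncomputable def pinchNeg : C(QuatSphere, QuatSphere) := pinchPos.comp ⟨Neg.neg, continuous_neg⟩

theorem pinchNeg_eq_one {q : QuatSphere} (hq : q.1.re ≤ 0) : pinchNeg q = 1 :=
  pinchPos_eq_one (q := -q) (by simpa using hq)

theorem homotopic_neg :
    (ContinuousMap.id QuatSphere).Homotopic ⟨Neg.neg, continuous_neg⟩ := by
  have : PathConnectedSpace QuatSphere := isPathConnected_iff_pathConnectedSpace.1
    (isPathConnected_sphere (by rw [Quaternion.rank_eq_four]; norm_num) _ zero_le_one)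
  let γ : Path (1 : QuatSphere) (-1) := PathConnectedSpace.somePath _ _
  refine ⟨⟨⟨fun x => γ x.1 * x.2, (γ.continuous.comp continuous_fst).mul continuous_snd⟩,
    fun q => ?_, fun q => ?_⟩⟩
  · change γ 0 * q = q
    rw [γ.source, one_mul]
  · change γ 1 * q = -q
    rw [γ.target]
    refine Subtype.ext ?_
    rw [Metric.unitSphere.coe_mul]
    simp

theorem homotopic_pinchNeg : (ContinuousMap.id QuatSphere).Homotopic pinchNeg :=
  homotopic_neg.trans (homotopic_pinchPos.comp
    (ContinuousMap.Homotopic.refl (⟨Neg.neg, continuous_neg⟩ : C(QuatSphere, QuatSphere))))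

end Pinch

section Additivity

theorem homotopic_comp_mul {G G' : Type*} [Group G] [TopologicalSpace G] [ContinuousMul G]
    [Group G'] [TopologicalSpace G'] [ContinuousMul G'] (f : C(G, G')) {u v : C(QuatSphere, G)}
    (hu : u 1 = 1) (hv : v 1 = 1) :
    (f.comp (u * v)).Homotopic ((f.comp u).comp pinchPos *
      (ContinuousMap.const _ (f 1)⁻¹ * (f.comp v).comp pinchNeg)) := by
  let K : C(QuatSphere × QuatSphere, G') :=
    ⟨fun x => f (u x.1 * v x.2), f.continuous.comp
      ((u.continuous.comp continuous_fst).mul (v.continuous.comp continuous_snd))⟩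
  have h1 : (f.comp (u * v)).Homotopic (K.comp (pinchPos.prodMk pinchNeg)) :=
    (ContinuousMap.Homotopic.refl K).comp (homotopic_pinchPos.prodMk homotopic_pinchNeg)
  have h2 : K.comp (pinchPos.prodMk pinchNeg) = (f.comp u).comp pinchPos *
      (ContinuousMap.const _ (f 1)⁻¹ * (f.comp v).comp pinchNeg) := by
    refine ContinuousMap.ext fun q => ?_
    change f (u (pinchPos q) * v (pinchNeg q)) =
      f (u (pinchPos q)) * ((f 1)⁻¹ * f (v (pinchNeg q)))
    rcases le_total 0 q.1.re with h | h
    · rw [pinchPos_eq_one h, hu, one_mul, mul_inv_cancel_left]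
    · rw [pinchNeg_eq_one h, hv, mul_one, inv_mul_cancel, mul_one]
  exact h2 ▸ h1

variable {k l : Type*} [Fintype k] [DecidableEq k] [Fintype l] [DecidableEq l]

theorem quatDeg_comp_mul (f : C(unitary (Matrix k k ℍ[ℝ]), unitary (Matrix l l ℍ[ℝ])))
    {u v : C(QuatSphere, unitary (Matrix k k ℍ[ℝ]))} (hu : u 1 = 1) (hv : v 1 = 1) :
    quatDeg (f.comp (u * v)) = quatDeg (f.comp u) + quatDeg (f.comp v) := by
  rw [quatDeg_congr (homotopic_comp_mul f hu hv), quatDeg_mul, quatDeg_mul, quatDeg_const,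
    zero_add, ← quatDeg_congr ((ContinuousMap.Homotopic.refl (f.comp u)).comp homotopic_pinchPos),
    ← quatDeg_congr ((ContinuousMap.Homotopic.refl (f.comp v)).comp homotopic_pinchNeg)]
  rfl

/-- The partial scalar matrices, with a unit quaternion in the diagonal entries indexed by `s`. -/
noncomputable def quatDiag (s : Finset k) : C(QuatSphere, unitary (Matrix k k ℍ[ℝ])) where
  toFun q := ⟨diagonal fun i => if i ∈ s then q.1 else 1, by
    have h1 : star q.1 * q.1 = 1 := by
      rw [Quaternion.star_mul_self, Quaternion.normSq_eq_norm_mul_self, norm_eq_of_mem_sphere]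
      simp
    have h2 : q.1 * star q.1 = 1 := by
      rw [Quaternion.self_mul_star, Quaternion.normSq_eq_norm_mul_self, norm_eq_of_mem_sphere]
      simp
    rw [Unitary.mem_iff]
    simp only [star_eq_conjTranspose, diagonal_conjTranspose, diagonal_mul_diagonal]
    constructor
    · rw [← diagonal_one]
      congr 1; ext1 i; simp only [Pi.star_apply]; split_ifs <;> simp [h1]
    · rw [← diagonal_one]
      congr 1; ext1 i; simp only [Pi.star_apply]; split_ifs <;> simp [h2]⟩
  continuous_toFun := by
    refine Continuous.subtype_mk (Continuous.matrix_diagonal (continuous_pi fun i => ?_)) _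
    split_ifs <;> fun_prop

theorem quatDiag_apply_one (s : Finset k) : quatDiag s 1 = 1 := by
  refine Subtype.ext ?_
  simp [quatDiag]

theorem quatDiag_empty : quatDiag (∅ : Finset k) = 1 := by
  refine ContinuousMap.ext fun q => Subtype.ext ?_
  simp [quatDiag]

theorem quatDiag_univ : quatDiag (Finset.univ : Finset k) = quatScalar := by
  refine ContinuousMap.ext fun q => Subtype.ext ?_
  simp [quatDiag, quatScalar]

theorem quatDiag_insert {s : Finset k} {i : k} (hi : i ∉ s) :
    quatDiag (insert i s) = quatDiag {i} * quatDiag s := by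
  refine ContinuousMap.ext fun q => Subtype.ext ?_
  simp only [quatDiag, ContinuousMap.coe_mk, ContinuousMap.mul_apply, Submonoid.coe_mul,
    diagonal_mul_diagonal]
  congr 1; ext1 j
  by_cases hj : j = i
  · subst hj; simp [hi]
  · simp [hj]

/-- The unitary matrix acting as `q` on the line spanned by a real unit vector. -/
noncomputable def rankOneUpdate (x : (k → ℝ) × QuatSphere) : Matrix k k ℍ[ℝ] :=
  1 + Matrix.scalar k (x.2.1 - 1) * (vecMulVec x.1 x.1).map (algebraMap ℝ ℍ[ℝ])

theorem continuous_rankOneUpdate : Continuous (rankOneUpdate (k := k)) := by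
  unfold rankOneUpdate
  simp only [Matrix.scalar_apply]
  have : Continuous (algebraMap ℝ ℍ[ℝ]) := continuous_algebraMap ℝ ℍ[ℝ]
  fun_prop

theorem rankOneUpdate_mem {v : k → ℝ} (hv : v ⬝ᵥ v = 1) (q : QuatSphere) :
    rankOneUpdate (v, q) ∈ unitary (Matrix k k ℍ[ℝ]) := by
  set P : Matrix k k ℍ[ℝ] := (vecMulVec v v).map (algebraMap ℝ ℍ[ℝ])
  have hP : P * P = P := by
    rw [← Matrix.map_mul, vecMulVec_mul_vecMulVec, hv, one_smul]
  have hPs : star P = P := by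
    ext1 a b
    simp [P, star_apply, vecMulVec_apply, Quaternion.star_coe, mul_comm, -Quaternion.coe_mul]
  have hcomm (c : ℍ[ℝ]) : Matrix.scalar k c * P = P * Matrix.scalar k c := by
    ext1 a b
    simp only [P, Matrix.scalar_apply, diagonal_mul, mul_diagonal, map_apply]
    exact (Algebra.commutes _ _).symm
  have hstar (c : ℍ[ℝ]) : star (Matrix.scalar k c) = Matrix.scalar k (star c) := by
    simp [Matrix.scalar_apply, star_eq_conjTranspose, diagonal_conjTranspose, Pi.star_def]
  have hq : q.1 * star q.1 = 1 := by
    rw [Quaternion.self_mul_star, Quaternion.normSq_eq_norm_mul_self, norm_eq_of_mem_sphere]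
    simp
  have key : rankOneUpdate (v, q) * star (rankOneUpdate (v, q)) = 1 := by
    change (1 + Matrix.scalar k (q.1 - 1) * P) * star (1 + Matrix.scalar k (q.1 - 1) * P) = 1
    rw [star_add, star_one, star_mul, hPs, hstar, star_sub, star_one, ← hcomm]
    have h1 : (Matrix.scalar k (q.1 - 1) * P) * (Matrix.scalar k (star q.1 - 1) * P) =
        Matrix.scalar k ((q.1 - 1) * (star q.1 - 1)) * P := by
      rw [mul_assoc, ← mul_assoc P, ← hcomm, mul_assoc, hP, ← mul_assoc, ← map_mul]
    have h2 : (q.1 - 1) * (star q.1 - 1) = -(q.1 - 1) - (star q.1 - 1) := by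
      rw [sub_mul, mul_sub, mul_sub, hq]; noncomm_ring
    rw [add_mul, mul_add, mul_add, h1, h2, map_sub _ (-(q.1 - 1)), map_neg]
    noncomm_ring
  exact Unitary.mem_iff.2 ⟨mul_eq_one_comm.1 key, key⟩

theorem rankOneUpdate_single (i : k) (q : QuatSphere) :
    rankOneUpdate (Pi.single i 1, q) = (quatDiag {i} q).1 := by
  ext1 a b
  simp only [rankOneUpdate, quatDiag, ContinuousMap.coe_mk, Matrix.add_apply, Matrix.scalar_apply,
    diagonal_mul, map_apply, vecMulVec_apply, Matrix.one_apply, diagonal_apply, Pi.single_apply,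
    Finset.mem_singleton]
  by_cases hab : a = b
  · subst hab
    by_cases hi : a = i <;> simp [hi]
  · by_cases hi : a = i
    · simp [hab, show b ≠ i from fun h => hab (hi.trans h.symm)]
    · simp [hab, hi]

theorem homotopic_quatDiag_singleton (i j : k) :
    (quatDiag {i}).Homotopic (quatDiag {j}) := by
  rcases eq_or_ne i j with rfl | hij
  · exact ContinuousMap.Homotopic.refl _
  let v (t : unitInterval) : k → ℝ :=
    Real.cos (t * (Real.pi / 2)) • Pi.single i 1 + Real.sin (t * (Real.pi / 2)) • Pi.single j 1
  have hv (t : unitInterval) : v t ⬝ᵥ v t = 1 := by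
    simp [v, hij, hij.symm, ← sq]
  have hvc : Continuous v := by fun_prop
  let H : C(unitInterval × QuatSphere, unitary (Matrix k k ℍ[ℝ])) :=
    ⟨fun x => ⟨rankOneUpdate (v x.1, x.2), rankOneUpdate_mem (hv x.1) x.2⟩,
      (continuous_rankOneUpdate.comp
        ((hvc.comp continuous_fst).prodMk continuous_snd)).subtype_mk _⟩
  have h0 : v 0 = Pi.single i 1 := by simp [v]
  have h1 : v 1 = Pi.single j 1 := by simp [v]
  refine ⟨⟨H, fun q => Subtype.ext ?_, fun q => Subtype.ext ?_⟩⟩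
  · rw [← rankOneUpdate_single, ← h0]
  · rw [← rankOneUpdate_single, ← h1]

theorem quatDeg_comp_quatScalar (f : C(unitary (Matrix k k ℍ[ℝ]), unitary (Matrix l l ℍ[ℝ])))
    (i : k) : quatDeg (f.comp quatScalar) = Fintype.card k * quatDeg (f.comp (quatDiag {i})) := by
  have h (s : Finset k) :
      quatDeg (f.comp (quatDiag s)) = s.card * quatDeg (f.comp (quatDiag {i})) := by
    induction s using Finset.induction_on with
    | empty =>
      rw [quatDiag_empty, Finset.card_empty, Nat.cast_zero, zero_mul]
      exact quatDeg_const (f 1)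
    | insert j s hj ih =>
      rw [quatDiag_insert hj, quatDeg_comp_mul f (quatDiag_apply_one _) (quatDiag_apply_one _), ih,
        Finset.card_insert_of_notMem hj,
        quatDeg_congr ((ContinuousMap.Homotopic.refl f).comp (homotopic_quatDiag_singleton j i))]
      push_cast; ring
  rw [← quatDiag_univ, h, Finset.card_univ]

theorem card_dvd_card_of_equivariant [Nonempty k]
    (f : C(unitary (Matrix k k ℍ[ℝ]), unitary (Matrix l l ℍ[ℝ])))
    (hf : ∀ (q : QuatSphere), f (quatScalar q) = quatScalar q * f 1) :
    Fintype.card k ∣ Fintype.card l := by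
  obtain ⟨i⟩ := ‹Nonempty k›
  have h1 : f.comp quatScalar = quatScalar * ContinuousMap.const _ (f 1) :=
    ContinuousMap.ext hf
  have h2 := quatDeg_comp_quatScalar f i
  rw [h1, quatDeg_mul, quatDeg_const, quatDeg_quatScalar, add_zero] at h2
  exact Int.natCast_dvd_natCast.1 ⟨_, h2⟩

end Additivity

section EquivariantMaps

theorem dvd_of_equivariant {n m : ℕ} (hn : 0 < n) {f : Sp n → Sp m} (hf : Continuous f)
    (heq : ∀ (q : ℍ[ℝ]), ‖q‖ = 1 → ∀ (A : Sp n) (h : (q • A.1) * (q • A.1)ᴴ = 1),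
      (f ⟨q • A.1, h⟩).1 = q • (f A).1) : n ∣ m := by
  have : Nonempty (Fin n) := ⟨⟨0, hn⟩⟩
  let F : C(unitary (Matrix (Fin n) (Fin n) ℍ[ℝ]), unitary (Matrix (Fin m) (Fin m) ℍ[ℝ])) :=
    ⟨fun A => ⟨(f ⟨A.1, A.2.2⟩).1, Unitary.mem_iff.2
        ⟨mul_eq_one_comm.1 (f ⟨A.1, A.2.2⟩).2, (f ⟨A.1, A.2.2⟩).2⟩⟩,
      (continuous_subtype_val.comp
        (hf.comp (continuous_subtype_val.subtype_mk _))).subtype_mk _⟩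
  have h := card_dvd_card_of_equivariant F fun q => Subtype.ext ?_
  · simpa using h
  · have hq : Matrix.scalar (Fin n) q.1 = q.1 • (1 : Matrix (Fin n) (Fin n) ℍ[ℝ]) := by
      rw [Matrix.scalar_apply, smul_one_eq_diagonal]
    have hmem : (q.1 • (1 : Matrix (Fin n) (Fin n) ℍ[ℝ])) * (q.1 • 1)ᴴ = 1 := by
      rw [← hq]; exact (scalar_mem_unitary q).2
    have h1 := heq q.1 (norm_eq_of_mem_sphere q) ⟨1, by simp⟩ hmem
    have h2 : (F (quatScalar q)).1 = (f ⟨q.1 • 1, hmem⟩).1 :=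
      congrArg (fun A => (f A).1) (Subtype.ext hq)
    rw [h2, h1, smul_eq_diagonal_mul]
    rfl

theorem exists_equivariant (n k : ℕ) : ∃ f : Sp n → Sp (n * k), Continuous f ∧
    ∀ (q : ℍ[ℝ]), ‖q‖ = 1 → ∀ (A : Sp n) (h : (q • A.1) * (q • A.1)ᴴ = 1),
      (f ⟨q • A.1, h⟩).1 = q • (f A).1 := by
  refine ⟨fun A => ⟨(blockDiagonal fun _ : Fin k => A.1).submatrix
    finProdFinEquiv.symm finProdFinEquiv.symm, ?_⟩, ?_, fun q _ A h => ?_⟩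
  · rw [conjTranspose_submatrix, submatrix_mul_equiv, blockDiagonal_conjTranspose,
      ← blockDiagonal_mul]
    simp only [A.2]
    rw [show (fun _ : Fin k => (1 : Matrix (Fin n) (Fin n) ℍ[ℝ])) = 1 from rfl,
      blockDiagonal_one, submatrix_one_equiv]
  · exact ((Continuous.matrix_blockDiagonal
      (continuous_pi fun _ => continuous_subtype_val)).matrix_submatrix _ _).subtype_mk _
  · change (blockDiagonal (q • fun _ : Fin k => A.1)).submatrix _ _ = _
    rw [blockDiagonal_smul]
    rfl

end EquivariantMaps

/-- For positive integers `n`, `m`, there exists an `S³`-equivariant continuous map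
`Sp(n) → Sp(m)` (equivariant for entrywise left multiplication by unit quaternions)
if and only if `n ∣ m`. -/
theorem stmt2 (n m : ℕ) (hn : 0 < n) (hm : 0 < m) :
    (∃ f : Sp n → Sp m, Continuous f ∧
      ∀ (q : ℍ[ℝ]), ‖q‖ = 1 → ∀ (A : Sp n) (h : (q • A.1) * (q • A.1)ᴴ = 1),
        (f ⟨q • A.1, h⟩).1 = q • (f A).1) ↔ n ∣ m := by
  constructor
  · rintro ⟨f, hf, heq⟩
    exact dvd_of_equivariant hn hf heq
  · rintro ⟨k, rfl⟩
    exact exists_equivariant n k
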